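/- arXiv:1809.02290 — 4 statements merged into one kernel-verified Lean document; each statement's English description precedes it below -/
import Mathlib

section
/- Let Ψ = (Ψ₀, Ψ₁) be a quantifier-free interdefinition between a Π₁ L₀-theory T₀ and a Π₁ L₁-theory T₁. Suppose μ is an invariant measure on Str_{L₀}(ℕ) concentrated on ⟦T₀⟧, and let ν be the pushforward of μ along the induced bijection Ψ*_{0,ℕ}: ⟦T₀⟧ → ⟦T₁⟧. Then ν is an invariant measure on Str_{L₁}(ℕ) concentrated on ⟦T₁⟧, and Ent(ν) = Ent(μ). -/
open FirstOrder MeasureTheory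
open scoped ENNReal

namespace PaperEntropy

/-- The logic action of a permutation of `ℕ` on the space of `L`-structures with
underlying set `ℕ`. -/
noncomputable def logicAction (L : FirstOrder.Language) (σ : Equiv.Perm ℕ)
    (S : L.Structure ℕ) : L.Structure ℕ where
  funMap := fun {m} f v => σ (@FirstOrder.Language.Structure.funMap L ℕ S m f
    (fun i => σ.symm (v i)))
  RelMap := fun {m} r v => @FirstOrder.Language.Structure.RelMap L ℕ S m r
    (fun i => σ.symm (v i))

/-- Generating sets for the σ-algebra on the space of `L`-structures on `M`:
satisfaction sets of quantifier-free formulas at tuples of parameters. -/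
def qfSets (L : FirstOrder.Language) (M : Type*) : Set (Set (L.Structure M)) :=
  { A | ∃ (m : ℕ) (φ : L.Formula (Fin m)), φ.IsQF ∧ ∃ v : Fin m → M,
      A = { S : L.Structure M | @FirstOrder.Language.Formula.Realize L M S (Fin m) φ v } }

noncomputable instance strMeasurableSpace (L : FirstOrder.Language) (M : Type*) :
    MeasurableSpace (L.Structure M) :=
  MeasurableSpace.generateFrom (qfSets L M)

/-- `μ` is an invariant (probability) measure on `Str_L(ℕ)`. -/
def IsInvariantMeasure (L : FirstOrder.Language) (μ : Measure (L.Structure ℕ)) : Prop :=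
  IsProbabilityMeasure μ ∧ ∀ σ : Equiv.Perm ℕ, Measure.map (logicAction L σ) μ = μ

/-- The set of non-redundant `L`-structures on `M`: relations hold only of tuples of
pairwise distinct elements. -/
def NonRedundant (L : FirstOrder.Language) (M : Type*) : Set (L.Structure M) :=
  { S | ∀ (m : ℕ) (r : L.Relations m) (v : Fin m → M),
      @FirstOrder.Language.Structure.RelMap L M S m r v → Function.Injective v }

/-- The data of the restriction of an `L`-structure on `ℕ` to `[n] = {0, …, n-1}`:
the relational part, and the functional part recorded as `none` on tuples whose image
under the function escapes `[n]`. -/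
structure FinRestriction (L : FirstOrder.Language) (n : ℕ) where
  rel : ∀ m, L.Relations m → (Fin m → Fin n) → Prop
  fn : ∀ m, L.Functions m → (Fin m → Fin n) → Option (Fin n)

instance finRestrictionMeasurableSpace (L : FirstOrder.Language) (n : ℕ) :
    MeasurableSpace (FinRestriction L n) :=
  MeasurableSpace.generateFrom
    ({ A | ∃ m r v, A = {x : FinRestriction L n | x.rel m r v} } ∪
     { A | ∃ m f v o, A = {x : FinRestriction L n | x.fn m f v = o} })

/-- The restriction of an `L`-structure on `ℕ` to `[n]`. -/
noncomputable def restrict (L : FirstOrder.Language) (n : ℕ) (S : L.Structure ℕ) :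
    FinRestriction L n where
  rel m r v := @FirstOrder.Language.Structure.RelMap L ℕ S m r (fun i => (v i : ℕ))
  fn m f v :=
    if h : (@FirstOrder.Language.Structure.funMap L ℕ S m f (fun i => (v i : ℕ))) < n
    then some ⟨_, h⟩ else none

/-- The entropy of a measure: `∞` if it is not purely atomic, and otherwise
`-∑ ν {x} log₂ ν {x}` over its atoms. -/
noncomputable def entropy {α : Type*} [MeasurableSpace α] (ν : Measure α) : ℝ≥0∞ :=
  if ∑' a : α, ν {a} = ν Set.univ then
    ∑' a : α, ENNReal.ofReal (-((ν {a}).toReal * Real.logb 2 (ν {a}).toReal))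
  else ⊤

/-- The entropy function of a measure on `Str_L(ℕ)`: the entropy of the measure induced
by restriction to `[n]`. -/
noncomputable def entFn (L : FirstOrder.Language) (μ : Measure (L.Structure ℕ)) (n : ℕ) :
    ℝ≥0∞ :=
  entropy (Measure.map (restrict L n) μ)

end PaperEntropy

namespace PaperEntropy

open FirstOrder MeasureTheory
open scoped ENNReal

/-- A theory is Π₁ when each of its sentences is quantifier-free or a universal
quantification of a quantifier-free formula. -/
def IsPi1 (L : FirstOrder.Language) (T : L.Theory) : Prop :=
  ∀ φ ∈ T, FirstOrder.Language.BoundedFormula.IsQF φ ∨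
    ∃ (n : ℕ) (ψ : L.BoundedFormula Empty n), ψ.IsQF ∧ φ = ψ.alls

/-- The extent of a theory: the set of structures on `ℕ` satisfying it. -/
def theoryExtent (L : FirstOrder.Language) (T : L.Theory) : Set (L.Structure ℕ) :=
  { S | ∀ φ ∈ T, @FirstOrder.Language.Sentence.Realize L ℕ S φ }

/-- A quantifier-free interdefinition between an `L₀`-theory `T₀` and an `L₁`-theory
`T₁`: a pair of maps of formulas, preserving free variables and quantifier-freeness,
which are inverse to each other modulo the theories, fix equality, and commute with
negation, conjunction and existential quantification modulo the theories. -/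
structure QFInterdefinition (L₀ L₁ : FirstOrder.Language)
    (T₀ : L₀.Theory) (T₁ : L₁.Theory) where
  psi₀ : ∀ (α : Type) (n : ℕ), L₀.BoundedFormula α n → L₁.BoundedFormula α n
  psi₁ : ∀ (α : Type) (n : ℕ), L₁.BoundedFormula α n → L₀.BoundedFormula α n
  qf₀ : ∀ (α : Type) (n : ℕ) (φ : L₀.BoundedFormula α n), φ.IsQF → (psi₀ α n φ).IsQF
  qf₁ : ∀ (α : Type) (n : ℕ) (φ : L₁.BoundedFormula α n), φ.IsQF → (psi₁ α n φ).IsQF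
  freeVar₀ : ∀ (α : Type) [DecidableEq α] (n : ℕ) (φ : L₀.BoundedFormula α n),
    (psi₀ α n φ).freeVarFinset = φ.freeVarFinset
  freeVar₁ : ∀ (α : Type) [DecidableEq α] (n : ℕ) (φ : L₁.BoundedFormula α n),
    (psi₁ α n φ).freeVarFinset = φ.freeVarFinset
  comp₀ : ∀ (α : Type) (n : ℕ) (ρ : L₁.BoundedFormula α n),
    FirstOrder.Language.Theory.Iff T₁ (psi₀ α n (psi₁ α n ρ)) ρ
  comp₁ : ∀ (α : Type) (n : ℕ) (ρ : L₀.BoundedFormula α n),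
    FirstOrder.Language.Theory.Iff T₀ (psi₁ α n (psi₀ α n ρ)) ρ
  eq₀ : ∀ (α : Type) (n : ℕ) (a b : α ⊕ Fin n),
    FirstOrder.Language.Theory.Iff T₁
      (psi₀ α n ((FirstOrder.Language.Term.var a).bdEqual (FirstOrder.Language.Term.var b)))
      ((FirstOrder.Language.Term.var a).bdEqual (FirstOrder.Language.Term.var b))
  eq₁ : ∀ (α : Type) (n : ℕ) (a b : α ⊕ Fin n),
    FirstOrder.Language.Theory.Iff T₀
      (psi₁ α n ((FirstOrder.Language.Term.var a).bdEqual (FirstOrder.Language.Term.var b)))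
      ((FirstOrder.Language.Term.var a).bdEqual (FirstOrder.Language.Term.var b))
  not₀ : ∀ (α : Type) (n : ℕ) (χ : L₀.BoundedFormula α n),
    FirstOrder.Language.Theory.Iff T₁ (psi₀ α n χ).not (psi₀ α n χ.not)
  not₁ : ∀ (α : Type) (n : ℕ) (χ : L₁.BoundedFormula α n),
    FirstOrder.Language.Theory.Iff T₀ (psi₁ α n χ).not (psi₁ α n χ.not)
  inf₀ : ∀ (α : Type) (n : ℕ) (χ φ : L₀.BoundedFormula α n),
    FirstOrder.Language.Theory.Iff T₁ (psi₀ α n (χ ⊓ φ)) (psi₀ α n χ ⊓ psi₀ α n φ)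
  inf₁ : ∀ (α : Type) (n : ℕ) (χ φ : L₁.BoundedFormula α n),
    FirstOrder.Language.Theory.Iff T₀ (psi₁ α n (χ ⊓ φ)) (psi₁ α n χ ⊓ psi₁ α n φ)
  ex₀ : ∀ (α : Type) (n : ℕ) (ψ : L₀.BoundedFormula α (n + 1)),
    FirstOrder.Language.Theory.Iff T₁ (psi₀ α (n + 1) ψ).ex (psi₀ α n ψ.ex)
  ex₁ : ∀ (α : Type) (n : ℕ) (ψ : L₁.BoundedFormula α (n + 1)),
    FirstOrder.Language.Theory.Iff T₀ (psi₁ α (n + 1) ψ).ex (psi₁ α n ψ.ex)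

end PaperEntropy

namespace PaperEntropy

open Set
open FirstOrder.Language

section Atoms

/-- Every nonzero measure on `Y` taking only the values zero and full mass is concentrated at
a point. -/
def ZeroOneMeasuresAreDirac (Y : Type*) [MeasurableSpace Y] : Prop :=
  ∀ ρ : Measure Y, ρ univ ≠ 0 → (∀ B, MeasurableSet B → ρ B = 0 ∨ ρ Bᶜ = 0) →
    ∃ b, ∀ B, MeasurableSet B → b ∉ B → ρ B = 0

variable {X Y Z : Type*} [MeasurableSpace X] [MeasurableSpace Y] [MeasurableSpace Z]

/-- The points `y` and `z` are the values of `f` and `g` on a common part of mass at least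
that of the fibre over `y`. -/
def MassTransfers (μ : Measure X) (f : X → Y) (g : X → Z) (y : Y) (z : Z) : Prop :=
  ∀ A B, MeasurableSet A → MeasurableSet B → y ∈ A → z ∈ B →
    Measure.map f μ {y} ≤ μ (f ⁻¹' A ∩ g ⁻¹' B)

variable {μ : Measure X} {f : X → Y} {g : X → Z}

theorem MassTransfers.map_singleton_le (hg : Measurable g) {y : Y} {z : Z}
    (h : MassTransfers μ f g y z) : Measure.map f μ {y} ≤ Measure.map g μ {z} := by
  rw [← measure_toMeasurable {z}, Measure.map_apply hg (measurableSet_toMeasurable _ _)]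
  simpa using h univ _ MeasurableSet.univ (measurableSet_toMeasurable _ _) (mem_univ _)
    (subset_toMeasurable (Measure.map g μ) {z} rfl)

theorem MassTransfers.eq_of_swap [IsFiniteMeasure μ] [MeasurableSpace.SeparatesPoints Y]
    (hf : Measurable f) (hg : Measurable g) {y y' : Y} {z : Z} (hy : Measure.map f μ {y} ≠ 0)
    (h : MassTransfers μ f g y z) (h' : MassTransfers μ g f z y') : y = y' := by
  by_contra hne
  obtain ⟨C, hC, hyC, hyC'⟩ := MeasurableSpace.exists_measurableSet_of_ne hne
  set B := toMeasurable (Measure.map g μ) {z}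
  have hB : MeasurableSet B := measurableSet_toMeasurable _ _
  have hzB : z ∈ B := subset_toMeasurable (Measure.map g μ) {z} rfl
  have h1 := h C B hC hB hyC hzB
  have h2 := h' B Cᶜ hB hC.compl hzB hyC'
  have hBm : Measure.map g μ {z} = μ (g ⁻¹' B) := by
    rw [← measure_toMeasurable {z}, Measure.map_apply hg hB]
  have h3 := measure_inter_add_sdiff (μ := μ) (g ⁻¹' B) (hf hC)
  rw [inter_comm] at h1
  rw [hBm, preimage_compl, ← sdiff_eq] at h2
  have h4 : μ (g ⁻¹' B ∩ f ⁻¹' C) = 0 := by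
    have h5 : μ (g ⁻¹' B ∩ f ⁻¹' C) + μ (g ⁻¹' B) ≤ 0 + μ (g ⁻¹' B) := by
      rw [zero_add]
      exact (add_le_add_right h2 _).trans_eq h3
    exact nonpos_iff_eq_zero.1 ((ENNReal.add_le_add_iff_right (measure_ne_top _ _)).1 h5)
  exact hy (nonpos_iff_eq_zero.1 (h4 ▸ h1))

theorem exists_massTransfers [IsFiniteMeasure μ] (hf : Measurable f) (hg : Measurable g)
    (hZ : ZeroOneMeasuresAreDirac Z)
    (hfg : MeasurableSpace.comap g inferInstance ≤
      eventuallyMeasurableSpace (MeasurableSpace.comap f inferInstance) (ae μ))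
    {y : Y} (hy : Measure.map f μ {y} ≠ 0) : ∃ z, MassTransfers μ f g y z := by
  set H := toMeasurable (Measure.map f μ) {y}
  have hH : MeasurableSet H := measurableSet_toMeasurable _ _
  have hyH : y ∈ H := subset_toMeasurable (Measure.map f μ) {y} rfl
  have hHm : Measure.map f μ H = Measure.map f μ {y} := measure_toMeasurable _
  have hfin : ∀ A, Measure.map f μ A ≠ ∞ := fun A => measure_ne_top _ _
  have null : ∀ A, MeasurableSet A → y ∉ A → μ (f ⁻¹' A ∩ f ⁻¹' H) = 0 := by
    intro A hA hyA
    have h1 := measure_inter_add_sdiff (μ := Measure.map f μ) H hA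
    have h2 : Measure.map f μ {y} ≤ Measure.map f μ (H \ A) :=
      measure_mono (singleton_subset_iff.2 ⟨hyH, hyA⟩)
    have h3 : Measure.map f μ (H ∩ A) = 0 := by
      have h5 : Measure.map f μ (H ∩ A) + Measure.map f μ H ≤ 0 + Measure.map f μ H := by
        rw [zero_add]
        exact (add_le_add_right (hHm.trans_le h2) _).trans_eq h1
      exact nonpos_iff_eq_zero.1 ((ENNReal.add_le_add_iff_right (hfin _)).1 h5)
    rwa [Measure.map_apply hf (hH.inter hA), preimage_inter, inter_comm] at h3
  have happ : ∀ B, MeasurableSet B →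
      Measure.map g (μ.restrict (f ⁻¹' H)) B = μ (g ⁻¹' B ∩ f ⁻¹' H) := fun B hB => by
    rw [Measure.map_apply hg hB, Measure.restrict_apply (hg hB)]
  have hz := hZ (Measure.map g (μ.restrict (f ⁻¹' H))) ?_ ?_
  · obtain ⟨z, hz⟩ := hz
    refine ⟨z, fun A B hA hB hyA hzB => ?_⟩
    have hA' := null Aᶜ hA.compl (by simpa using hyA)
    have hB' := hz Bᶜ hB.compl (by simpa using hzB)
    rw [happ _ hB.compl] at hB'
    rw [← hHm, Measure.map_apply hf hH]
    calc μ (f ⁻¹' H) ≤ μ ((f ⁻¹' A ∩ g ⁻¹' B) ∪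
          ((f ⁻¹' Aᶜ ∩ f ⁻¹' H) ∪ (g ⁻¹' Bᶜ ∩ f ⁻¹' H))) := by
          refine measure_mono fun x hx => ?_
          by_cases h1 : f x ∈ A <;> by_cases h2 : g x ∈ B <;>
            simp_all
      _ ≤ μ (f ⁻¹' A ∩ g ⁻¹' B) + (0 + 0) := by
          refine (measure_union_le _ _).trans (add_le_add_right ?_ _)
          refine (measure_union_le _ _).trans ?_
          rw [hA', hB']
      _ = _ := by simp
  · rw [happ _ MeasurableSet.univ, preimage_univ, univ_inter, ← Measure.map_apply hf hH, hHm]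
    exact hy
  · intro B hB
    rw [happ _ hB, happ _ hB.compl]
    obtain ⟨_, ⟨A, hA, rfl⟩, hAB⟩ := hfg _ ⟨B, hB, rfl⟩
    by_cases hyA : y ∈ A
    · right
      rw [preimage_compl]
      rw [measure_congr (hAB.compl.inter (ae_eq_refl (f ⁻¹' H))), ← preimage_compl]
      exact null _ hA.compl (by simpa using hyA)
    · left
      rw [measure_congr (hAB.inter (ae_eq_refl (f ⁻¹' H)))]
      exact null _ hA hyA

/-- Entropy depends only on the σ-algebra of sets pulled back, modulo null sets. -/
theorem entropy_map_eq [IsFiniteMeasure μ]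
    [MeasurableSpace.SeparatesPoints Y] [MeasurableSpace.SeparatesPoints Z]
    (hf : Measurable f) (hg : Measurable g)
    (hY : ZeroOneMeasuresAreDirac Y) (hZ : ZeroOneMeasuresAreDirac Z)
    (hfg : MeasurableSpace.comap g inferInstance ≤
      eventuallyMeasurableSpace (MeasurableSpace.comap f inferInstance) (ae μ))
    (hgf : MeasurableSpace.comap f inferInstance ≤
      eventuallyMeasurableSpace (MeasurableSpace.comap g inferInstance) (ae μ)) :
    entropy (Measure.map f μ) = entropy (Measure.map g μ) := by
  choose φ hφ using fun y : {y // Measure.map f μ {y} ≠ 0} =>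
    exists_massTransfers hf hg hZ hfg y.2
  choose ψ hψ using fun z : {z // Measure.map g μ {z} ≠ 0} =>
    exists_massTransfers hg hf hY hgf z.2
  have hφ0 : ∀ y, Measure.map g μ {φ y} ≠ 0 := fun y h =>
    y.2 (nonpos_iff_eq_zero.1 (((hφ y).map_singleton_le hg).trans_eq h))
  have hψ0 : ∀ z, Measure.map f μ {ψ z} ≠ 0 := fun z h =>
    z.2 (nonpos_iff_eq_zero.1 (((hψ z).map_singleton_le hf).trans_eq h))
  let e : {y // Measure.map f μ {y} ≠ 0} ≃ {z // Measure.map g μ {z} ≠ 0} :=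
    { toFun := fun y => ⟨φ y, hφ0 y⟩
      invFun := fun z => ⟨ψ z, hψ0 z⟩
      left_inv := fun y => Subtype.ext
        ((hφ y).eq_of_swap hf hg y.2 (hψ ⟨φ y, hφ0 y⟩)).symm
      right_inv := fun z => Subtype.ext
        ((hψ z).eq_of_swap hg hf z.2 (hφ ⟨ψ z, hψ0 z⟩)).symm }
  have he : ∀ y, Measure.map g μ {(e y : Z)} = Measure.map f μ {(y : Y)} := fun y => by
    refine le_antisymm ?_ ((hφ y).map_singleton_le hg)
    have h := (hψ (e y)).map_singleton_le hf
    rwa [show ψ (e y) = y from congrArg Subtype.val (e.left_inv y)] at h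
  have hsum : ∀ F : ℝ≥0∞ → ℝ≥0∞, F 0 = 0 →
      ∑' y, F (Measure.map f μ {y}) = ∑' z, F (Measure.map g μ {z}) := by
    intro F hF
    rw [← tsum_subtype_eq_of_support_subset (s := {y | Measure.map f μ {y} ≠ 0})
        (fun y hy h => hy (by simp [h, hF])),
      ← tsum_subtype_eq_of_support_subset (s := {z | Measure.map g μ {z} ≠ 0})
        (fun z hz h => hz (by simp [h, hF]))]
    refine Eq.trans ?_ (e.tsum_eq _)
    exact tsum_congr fun y => by rw [he]
  have hu : Measure.map f μ univ = Measure.map g μ univ := by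
    rw [Measure.map_apply hf .univ, Measure.map_apply hg .univ, preimage_univ, preimage_univ]
  unfold entropy
  rw [hu, hsum (fun x => x) rfl,
    hsum (fun x => ENNReal.ofReal (-(x.toReal * Real.logb 2 x.toReal))) (by simp)]

end Atoms

section FinRestriction

variable {L : FirstOrder.Language} {n : ℕ}

theorem FinRestriction.measurableSet_rel {m : ℕ} (r : L.Relations m) (v : Fin m → Fin n) :
    MeasurableSet {x : FinRestriction L n | x.rel m r v} :=
  MeasurableSpace.measurableSet_generateFrom (Or.inl ⟨m, r, v, rfl⟩)

theorem FinRestriction.measurableSet_fn {m : ℕ} (f : L.Functions m) (v : Fin m → Fin n)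
    (o : Option (Fin n)) : MeasurableSet {x : FinRestriction L n | x.fn m f v = o} :=
  MeasurableSpace.measurableSet_generateFrom (Or.inr ⟨m, f, v, o, rfl⟩)

instance : MeasurableSpace.SeparatesPoints (FinRestriction L n) where
  separates := by
    intro x y h
    obtain ⟨r, f⟩ := x
    obtain ⟨r', f'⟩ := y
    congr
    · funext m R v
      by_contra hne
      have h1 := h _ (FinRestriction.measurableSet_rel R v)
      have h2 := h _ (FinRestriction.measurableSet_rel R v).compl
      simp only [mem_ofPred_eq, mem_compl_iff] at h1 h2
      exact hne (propext ⟨h1, fun h => by tauto⟩)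
    · funext m F v
      exact (h _ (FinRestriction.measurableSet_fn F v (f m F v)) rfl).symm

theorem zeroOneMeasuresAreDirac_finRestriction :
    ZeroOneMeasuresAreDirac (FinRestriction L n) := by
  intro ρ hρ h01
  have hfn : ∀ m (f : L.Functions m) (v : Fin m → Fin n),
      ∃ o, ρ {x | x.fn m f v = o} ≠ 0 := by
    intro m f v
    by_contra! h
    refine hρ ?_
    rw [show (univ : Set (FinRestriction L n)) = ⋃ o, {x | x.fn m f v = o} by ext; simp]
    exact measure_iUnion_null h
  choose F hF using hfn
  let b : FinRestriction L n := ⟨fun m r v => ρ {x | x.rel m r v} ≠ 0, F⟩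
  have key : ∀ B, MeasurableSet B → (b ∉ B → ρ B = 0) ∧ (b ∈ B → ρ Bᶜ = 0) := by
    intro B hB
    induction B, hB using MeasurableSpace.generateFrom_induction with
    | hC B hB hBm =>
      obtain ⟨m, r, v, rfl⟩ | ⟨m, f, v, o, rfl⟩ := hB
      · exact ⟨fun h => not_not.1 h, fun h => (h01 _ hBm).resolve_left h⟩
      · have h1 := (h01 _ (FinRestriction.measurableSet_fn f v _)).resolve_left (hF m f v)
        refine ⟨fun h => measure_mono_null ?_ h1, fun h => ?_⟩
        · rintro x (hx : _ = _) (hx' : _ = _)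
          exact h (hx'.symm.trans hx)
        · rwa [show o = F m f v from Eq.symm h]
    | empty => exact ⟨by simp, by simp⟩
    | compl B hB ih => exact ⟨fun h => ih.2 (not_not.1 h), fun h => by simpa using ih.1 h⟩
    | iUnion B hB ih =>
      refine ⟨fun h => measure_iUnion_null fun i => (ih i).1 fun hi => h (mem_iUnion.2 ⟨i, hi⟩),
        fun h => ?_⟩
      obtain ⟨i, hi⟩ := mem_iUnion.1 h
      exact measure_mono_null (compl_subset_compl.2 (subset_iUnion _ i)) ((ih i).2 hi)
  exact ⟨b, fun B hB => (key B hB).1⟩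

end FinRestriction

section Structures

variable {L : FirstOrder.Language}

theorem measurableSet_realize {M : Type*} {m : ℕ} {φ : L.Formula (Fin m)} (hφ : φ.IsQF)
    (v : Fin m → M) :
    MeasurableSet {S : L.Structure M | @Formula.Realize L M S (Fin m) φ v} :=
  MeasurableSpace.measurableSet_generateFrom ⟨m, φ, hφ, v, rfl⟩

/-- The atomic formula expressing that a relation holds of the variables in order. -/
def relFormula {m : ℕ} (r : L.Relations m) : L.Formula (Fin m) := r.formula Term.var

theorem isQF_relFormula {m : ℕ} (r : L.Relations m) : (relFormula r).IsQF :=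
  (BoundedFormula.IsAtomic.rel r _).isQF

theorem realize_relFormula {M : Type*} [L.Structure M] {m : ℕ} (r : L.Relations m)
    (v : Fin m → M) : (relFormula r).Realize v ↔ Structure.RelMap r v :=
  Formula.realize_rel

theorem isQF_graph {m : ℕ} (f : L.Functions m) : (Formula.graph f).IsQF :=
  (BoundedFormula.IsAtomic.equal _ _).isQF

theorem measurableSet_funMap {M : Type*} {m : ℕ} (f : L.Functions m) (v : Fin m → M) (k : M) :
    MeasurableSet {S : L.Structure M | @Structure.funMap L M S m f v = k} := by
  convert measurableSet_realize (isQF_graph f) (Fin.cons k v : Fin (m + 1) → M) using 3 with S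
  exact (@Formula.realize_graph L M S m f v k).symm

/-- A permutation is an isomorphism onto the structure it transports. -/
def logicActionEquiv (σ : Equiv.Perm ℕ) (S : L.Structure ℕ) :
    @Language.Equiv L ℕ ℕ S (logicAction L σ S) :=
  @Language.Equiv.mk L ℕ ℕ S (logicAction L σ S) σ
    (fun {m} f x => by
      change σ _ = σ (@Structure.funMap L ℕ S m f _)
      simp)
    (fun {m} r x => by
      change @Structure.RelMap L ℕ S m r _ ↔ _
      simp)

theorem realize_equiv {M N α : Type*} [L.Structure M] [L.Structure N] (e : M ≃[L] N)
    (φ : L.Formula α) (v : α → N) : φ.Realize v ↔ φ.Realize (fun a => e.symm (v a)) := by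
  rw [← StrongHomClass.realize_formula e φ]
  simp [Function.comp_def]

theorem realize_logicAction (σ : Equiv.Perm ℕ) (S : L.Structure ℕ) {α : Type*}
    (φ : L.Formula α) (v : α → ℕ) :
    @Formula.Realize L ℕ (logicAction L σ S) α φ v ↔
      @Formula.Realize L ℕ S α φ (fun a => σ.symm (v a)) :=
  @realize_equiv L ℕ ℕ α S (logicAction L σ S) (logicActionEquiv σ S) φ v

theorem realize_sentence_equiv {M N : Type*} [L.Structure M] [L.Structure N] (e : M ≃[L] N)
    (φ : L.Sentence) : M ⊨ φ ↔ N ⊨ φ :=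
  StrongHomClass.realize_sentence e φ

theorem logicAction_mem_theoryExtent (σ : Equiv.Perm ℕ) {T : L.Theory} {S : L.Structure ℕ}
    (hS : S ∈ theoryExtent L T) : logicAction L σ S ∈ theoryExtent L T := fun φ hφ =>
  (@realize_sentence_equiv L ℕ ℕ S (logicAction L σ S) (logicActionEquiv σ S) φ).1 (hS φ hφ)

theorem measurable_logicAction (σ : Equiv.Perm ℕ) : Measurable (logicAction L σ) := by
  refine measurable_generateFrom ?_
  rintro _ ⟨m, φ, hφ, v, rfl⟩
  convert measurableSet_realize hφ (fun a => σ.symm (v a)) using 1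
  ext S
  exact realize_logicAction σ S φ v

theorem structure_eq_of_realize {M : Type*} {S S' : L.Structure M}
    (h : ∀ (m : ℕ) (φ : L.Formula (Fin m)) (v : Fin m → M),
      @Formula.Realize L M S (Fin m) φ v ↔ @Formula.Realize L M S' (Fin m) φ v) : S = S' := by
  refine Structure.ext ?_ ?_
  · funext m f v
    have := h _ (Formula.graph f) (Fin.cons (@Structure.funMap L M S m f v) v : Fin (m + 1) → M)
    rw [@Formula.realize_graph L M S, @Formula.realize_graph L M S'] at this
    exact (this.1 rfl).symm
  · funext m r v
    have := h _ (relFormula r) v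
    rw [@realize_relFormula L M S, @realize_relFormula L M S'] at this
    exact propext this

theorem realize_iff_of_theoryIff {T : L.Theory} {α : Type} {φ ψ : L.Formula α}
    (h : Theory.Iff T φ ψ) {S : L.Structure ℕ} (hS : S ∈ theoryExtent L T) (v : α → ℕ) :
    @Formula.Realize L ℕ S α φ v ↔ @Formula.Realize L ℕ S α ψ v :=
  letI := S
  haveI : (ℕ : Type) ⊨ T := ⟨fun φ hφ => hS φ hφ⟩
  Theory.Iff.realize_iff h

theorem measurable_restrict_comp {X : Type*} [MeasurableSpace X] {n : ℕ} {g : X → L.Structure ℕ}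
    (h : ∀ (m : ℕ) (φ : L.Formula (Fin m)), φ.IsQF → ∀ v : Fin m → ℕ, (∀ i, v i < n) →
      MeasurableSet {x | @Formula.Realize L ℕ (g x) (Fin m) φ v}) :
    Measurable (restrict L n ∘ g) := by
  have hsome : ∀ (m : ℕ) (f : L.Functions m) (v : Fin m → Fin n) (k : Fin n),
      MeasurableSet (restrict L n ∘ g ⁻¹' {x | x.fn m f v = some k}) := by
    intro m f v k
    convert h _ (Formula.graph f) (isQF_graph f)
      (Fin.cons (k : ℕ) (fun i => (v i : ℕ)) : Fin (m + 1) → ℕ)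
      (Fin.cases (by simp) fun i => by simp) using 1
    ext x
    refine Iff.trans ?_ (@Formula.realize_graph L ℕ (g x) m f _ _).symm
    simp only [restrict, Function.comp_apply, mem_preimage, mem_ofPred_eq,
      Option.dite_none_right_eq_some, Option.some.injEq, Fin.ext_iff, exists_prop]
    exact ⟨And.right, fun h' => ⟨h' ▸ k.2, h'⟩⟩
  refine measurable_generateFrom ?_
  rintro _ (⟨m, r, v, rfl⟩ | ⟨m, f, v, _ | k, rfl⟩)
  · convert h m (relFormula r) (isQF_relFormula r) (fun i => (v i : ℕ)) (fun i => (v i).2) using 1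
    ext x
    exact (@realize_relFormula L ℕ (g x) m r _).symm
  · have : {x : FinRestriction L n | x.fn m f v = none} =
        (⋃ k, {x : FinRestriction L n | x.fn m f v = some k})ᶜ := by
      ext x
      cases h : x.fn m f v <;> simp [h]
    rw [this, preimage_compl, preimage_iUnion]
    exact (MeasurableSet.iUnion fun k => hsome m f v k).compl
  · exact hsome m f v k

theorem measurable_restrict (n : ℕ) : Measurable (restrict L n) :=
  measurable_restrict_comp (g := id) fun _ _ hφ v _ => measurableSet_realize hφ v

/-- Function symbols are almost surely interpreted by choice functions. -/
theorem ae_funMap_mem_range {μ : Measure (L.Structure ℕ)} (hμ : IsInvariantMeasure L μ)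
    {m : ℕ} (f : L.Functions m) (w : Fin m → ℕ) :
    ∀ᵐ S ∂μ, @Structure.funMap L ℕ S m f w ∈ range w := by
  have := hμ.1
  let A : ℕ → Set (L.Structure ℕ) := fun k => {S | @Structure.funMap L ℕ S m f w = k}
  have hA : ∀ k, MeasurableSet (A k) := measurableSet_funMap f w
  have hdisj : Pairwise (Function.onFun Disjoint A) := fun i j hij =>
    disjoint_left.2 fun S (hi : _ = _) (hj : _ = _) => hij (hi.symm.trans hj)
  have heq : ∀ k ∉ range w, ∀ k' ∉ range w, μ (A k) = μ (A k') := by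
    intro k hk k' hk'
    conv_rhs => rw [← hμ.2 (Equiv.swap k k')]
    rw [Measure.map_apply (measurable_logicAction _) (hA k')]
    congr 1
    ext S
    have hw : (fun i => (Equiv.swap k k').symm (w i)) = w := by
      funext i
      rw [Equiv.symm_swap]
      exact Equiv.swap_apply_of_ne_of_ne (fun h => hk ⟨i, h⟩) (fun h => hk' ⟨i, h⟩)
    change _ = k ↔ Equiv.swap k k' (@Structure.funMap L ℕ S m f _) = k'
    rw [hw, ← Equiv.eq_symm_apply]
    simp
  have hnull : ∀ k ∉ range w, μ (A k) = 0 := by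
    intro k hk
    by_contra hne
    have hfin := Measure.finite_const_le_meas_of_disjoint_iUnion μ (pos_iff_ne_zero.2 hne) hA
      hdisj (measure_ne_top _ _)
    refine (finite_range w).infinite_compl (hfin.subset fun k' hk' => ?_)
    exact (heq k hk k' hk').le
  have hall : ∀ᵐ S ∂μ, ∀ k, k ∉ range w → @Structure.funMap L ℕ S m f w ≠ k := by
    rw [ae_all_iff]
    intro k
    by_cases hk : k ∈ range w
    · simp [hk]
    · have : ∀ᵐ S ∂μ, S ∉ A k := measure_eq_zero_iff_ae_notMem.1 (hnull k hk)
      filter_upwards [this] with S hS _ using hS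
  filter_upwards [hall] with S hS
  by_contra h
  exact hS _ h rfl

section Restrict

variable {μ : Measure (L.Structure ℕ)} {n : ℕ}

/-- The sets of structures determined, modulo null sets, by the restriction to `[n]`. -/
@[reducible]
noncomputable def restrictSpace (μ : Measure (L.Structure ℕ)) (n : ℕ) : MeasurableSpace (L.Structure ℕ) :=
  eventuallyMeasurableSpace (MeasurableSpace.comap (restrict L n) inferInstance) (ae μ)

theorem measurableSet_restrictSpace_preimage {A : Set (FinRestriction L n)}
    (hA : MeasurableSet A) : MeasurableSet[restrictSpace μ n] (restrict L n ⁻¹' A) :=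
  le_eventuallyMeasurableSpace _ ⟨A, hA, rfl⟩

theorem measurableSet_restrictSpace_congr {s t : Set (L.Structure ℕ)}
    (ht : MeasurableSet[restrictSpace μ n] t) (h : ∀ᵐ S ∂μ, S ∈ s ↔ S ∈ t) :
    MeasurableSet[restrictSpace μ n] s :=
  EventuallyMeasurableSet.congr ht (Filter.eventuallyEq_set.2 h)

theorem restrict_realize_term (hμ : IsInvariantMeasure L μ) {α : Type*} (t : L.Term α)
    (v : α → ℕ) (hv : ∀ a, v a < n) :
    (∀ᵐ S ∂μ, @Term.realize L ℕ S α v t < n) ∧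
      ∀ k : ℕ, MeasurableSet[restrictSpace μ n] {S | @Term.realize L ℕ S α v t = k} := by
  induction t with
  | var a => exact ⟨ae_of_all _ fun S => hv a, fun k => MeasurableSet.const (v a = k)⟩
  | @func l f ts ih =>
    have hts : ∀ᵐ S ∂μ, ∀ i, @Term.realize L ℕ S α v (ts i) < n :=
      ae_all_iff.2 fun i => (ih i).1
    have hf : ∀ᵐ S ∂μ, ∀ w : Fin l → ℕ, @Structure.funMap L ℕ S l f w ∈ range w :=
      ae_all_iff.2 fun w => ae_funMap_mem_range hμ f w
    have hlt : ∀ᵐ S ∂μ, @Term.realize L ℕ S α v (Term.func f ts) < n := by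
      filter_upwards [hts, hf] with S h1 h2
      obtain ⟨i, hi⟩ := h2 fun i => @Term.realize L ℕ S α v (ts i)
      exact Eq.trans_lt hi.symm (h1 i)
    refine ⟨hlt, fun k => ?_⟩
    by_cases hk : k < n
    · have hU : MeasurableSet[restrictSpace μ n] (⋃ w : Fin l → Fin n,
          (⋂ i, {S | @Term.realize L ℕ S α v (ts i) = w i}) ∩
            restrict L n ⁻¹' {x | x.fn l f w = some ⟨k, hk⟩}) :=
        MeasurableSet.iUnion fun w => MeasurableSet.inter
          (MeasurableSet.iInter fun i => (ih i).2 _)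
          (measurableSet_restrictSpace_preimage (FinRestriction.measurableSet_fn f w _))
      refine measurableSet_restrictSpace_congr hU ?_
      filter_upwards [hts] with S h1
      simp only [mem_ofPred_eq, mem_iUnion, mem_inter_iff, mem_iInter, mem_preimage, restrict,
        Option.dite_none_right_eq_some, Option.some.injEq, Fin.mk.injEq, exists_prop]
      constructor
      · intro h
        exact ⟨fun i => ⟨_, h1 i⟩, fun i => rfl, h.trans_lt hk, h⟩
      · rintro ⟨w, hw, -, h⟩
        rw [← h]
        exact congrArg _ (funext hw)
    · refine measurableSet_restrictSpace_congr (@MeasurableSet.empty _ (restrictSpace μ n)) ?_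
      filter_upwards [hlt] with S h
      simp only [mem_empty_iff_false, iff_false]
      exact fun h' => hk (h' ▸ h)

/-- Quantifier-free properties of elements of `[n]` are almost surely determined by the
restriction to `[n]`. -/
theorem restrict_realize_of_isQF (hμ : IsInvariantMeasure L μ) {α : Type*} {m : ℕ}
    {φ : L.BoundedFormula α m} (hφ : φ.IsQF) (v : α → ℕ) (xs : Fin m → ℕ) (hv : ∀ a, v a < n)
    (hxs : ∀ i, xs i < n) :
    MeasurableSet[restrictSpace μ n] {S | @BoundedFormula.Realize L ℕ S α m φ v xs} := by
  have hvx : ∀ a, Sum.elim v xs a < n := Sum.rec hv hxs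
  induction hφ with
  | falsum => exact @MeasurableSet.empty _ (restrictSpace μ n)
  | of_isAtomic h =>
    cases h with
    | equal t₁ t₂ =>
      have h1 := (restrict_realize_term hμ t₁ _ hvx).2
      have h2 := (restrict_realize_term hμ t₂ _ hvx).2
      have hU := MeasurableSet.iUnion fun k => (h1 k).inter (h2 k)
      refine measurableSet_restrictSpace_congr hU (ae_of_all _ fun S => ?_)
      simp only [mem_ofPred_eq, mem_iUnion, mem_inter_iff]
      constructor
      · exact fun h => ⟨_, rfl, Eq.symm h⟩
      · rintro ⟨k, h, h'⟩
        exact h.trans h'.symm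
    | @rel l R ts =>
      have hts : ∀ᵐ S ∂μ, ∀ i, @Term.realize L ℕ S _ (Sum.elim v xs) (ts i) < n :=
        ae_all_iff.2 fun i => (restrict_realize_term hμ (ts i) _ hvx).1
      have hU : MeasurableSet[restrictSpace μ n] (⋃ w : Fin l → Fin n,
          (⋂ i, {S | @Term.realize L ℕ S _ (Sum.elim v xs) (ts i) = w i}) ∩
            restrict L n ⁻¹' {x | x.rel l R w}) :=
        MeasurableSet.iUnion fun w => MeasurableSet.inter
          (MeasurableSet.iInter fun i => (restrict_realize_term hμ (ts i) _ hvx).2 _)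
          (measurableSet_restrictSpace_preimage (FinRestriction.measurableSet_rel R w))
      refine measurableSet_restrictSpace_congr hU ?_
      filter_upwards [hts] with S h1
      simp only [mem_ofPred_eq, mem_iUnion, mem_inter_iff, mem_iInter, mem_preimage, restrict]
      constructor
      · intro h
        exact ⟨fun i => ⟨_, h1 i⟩, fun i => rfl, h⟩
      · rintro ⟨w, hw, h⟩
        have : (fun i => @Term.realize L ℕ S _ (Sum.elim v xs) (ts i)) = fun i => (w i : ℕ) :=
          funext hw
        change @Structure.RelMap L ℕ S l R _
        rwa [this]
  | imp _ _ ih₁ ih₂ =>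
    refine measurableSet_restrictSpace_congr (ih₁.compl.union ih₂)
      (ae_of_all _ fun S => ?_)
    simp only [mem_ofPred_eq, mem_union, mem_compl_iff]
    exact imp_iff_not_or

theorem restrict_realize_formula (hμ : IsInvariantMeasure L μ) {m : ℕ} {φ : L.Formula (Fin m)}
    (hφ : φ.IsQF) (v : Fin m → ℕ) (hv : ∀ i, v i < n) :
    MeasurableSet[restrictSpace μ n] {S | @Formula.Realize L ℕ S (Fin m) φ v} := by
  unfold Formula.Realize
  exact restrict_realize_of_isQF hμ hφ v _ hv fun i => i.elim0

end Restrict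

end Structures

section Interdefinition

/-- Measurable sets agreeing on a set of full outer measure agree almost everywhere. -/
theorem ae_mem_iff_of_measure_eq_one {X : Type*} [MeasurableSpace X] {μ : Measure X}
    [IsProbabilityMeasure μ] {E s t : Set X} (hE : μ E = 1) (hs : MeasurableSet s)
    (ht : MeasurableSet t) (h : ∀ x ∈ E, x ∈ s ↔ x ∈ t) : ∀ᵐ x ∂μ, x ∈ s ↔ x ∈ t := by
  have hm : MeasurableSet {x | x ∈ s ↔ x ∈ t} := by measurability
  refine (prob_compl_eq_zero_iff hm).2 (le_antisymm prob_le_one ?_)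
  rw [← hE]
  exact measure_mono h

variable {L₀ L₁ : FirstOrder.Language} {T₀ : L₀.Theory} {T₁ : L₁.Theory}
  {Ψ : QFInterdefinition L₀ L₁ T₀ T₁} {μ : Measure (L₀.Structure ℕ)}
  {g : L₀.Structure ℕ → L₁.Structure ℕ}

/-- The map `g` acts on models of `T₀` as prescribed by the interdefinition. -/
def Induces (Ψ : QFInterdefinition L₀ L₁ T₀ T₁) (g : L₀.Structure ℕ → L₁.Structure ℕ) : Prop :=
  ∀ S ∈ theoryExtent L₀ T₀, ∀ (m : ℕ) (φ : L₁.Formula (Fin m)) (v : Fin m → ℕ),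
    @Formula.Realize L₁ ℕ (g S) (Fin m) φ v ↔
      @Formula.Realize L₀ ℕ S (Fin m) (Ψ.psi₁ (Fin m) 0 φ) v

theorem Induces.realize_psi₀ (hg : Induces Ψ g) {S : L₀.Structure ℕ}
    (hS : S ∈ theoryExtent L₀ T₀) {m : ℕ} (φ : L₀.Formula (Fin m)) (v : Fin m → ℕ) :
    @Formula.Realize L₁ ℕ (g S) (Fin m) (Ψ.psi₀ (Fin m) 0 φ) v ↔
      @Formula.Realize L₀ ℕ S (Fin m) φ v :=
  (hg S hS m _ v).trans (realize_iff_of_theoryIff (Ψ.comp₁ (Fin m) 0 φ) hS v)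

theorem Induces.map_logicAction (hg : Induces Ψ g) (σ : Equiv.Perm ℕ) {S : L₀.Structure ℕ}
    (hS : S ∈ theoryExtent L₀ T₀) : g (logicAction L₀ σ S) = logicAction L₁ σ (g S) := by
  refine structure_eq_of_realize fun m φ v => ?_
  rw [hg _ (logicAction_mem_theoryExtent σ hS), realize_logicAction, realize_logicAction, hg S hS]

theorem Induces.isInvariantMeasure_map (hg : Induces Ψ g) (hgm : Measurable g)
    (hμ : IsInvariantMeasure L₀ μ) (hconc : μ (theoryExtent L₀ T₀) = 1) :
    IsInvariantMeasure L₁ (Measure.map g μ) := by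
  have := hμ.1
  refine ⟨Measure.isProbabilityMeasure_map hgm.aemeasurable, fun σ => ?_⟩
  ext A hA
  have h₀ := measurable_logicAction (L := L₀) σ
  have h₁ := measurable_logicAction (L := L₁) σ
  conv_rhs => rw [← hμ.2 σ]
  rw [Measure.map_map h₁ hgm, Measure.map_map hgm h₀, Measure.map_apply (h₁.comp hgm) hA,
    Measure.map_apply (hgm.comp h₀) hA]
  refine measure_congr (Filter.eventuallyEq_set.2 (ae_mem_iff_of_measure_eq_one hconc
    ((h₁.comp hgm) hA) ((hgm.comp h₀) hA) fun S hS => ?_))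
  simp only [mem_preimage, Function.comp_apply, hg.map_logicAction σ hS]

theorem Induces.comap_restrict_comp_le (hg : Induces Ψ g) (hgm : Measurable g)
    (hμ : IsInvariantMeasure L₀ μ) (hconc : μ (theoryExtent L₀ T₀) = 1) (n : ℕ) :
    MeasurableSpace.comap (restrict L₁ n ∘ g) inferInstance ≤ restrictSpace μ n := by
  have := hμ.1
  refine Measurable.comap_le (@measurable_restrict_comp L₁ _ (restrictSpace μ n) n g ?_)
  intro m φ hφ v hv
  have hψ := Ψ.qf₁ (Fin m) 0 φ hφ
  exact measurableSet_restrictSpace_congr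
    (restrict_realize_formula hμ hψ v hv)
    (ae_mem_iff_of_measure_eq_one hconc (hgm (measurableSet_realize hφ v))
      (measurableSet_realize hψ v) fun S hS => hg S hS m φ v)

theorem Induces.comap_restrict_le (hg : Induces Ψ g) (hgm : Measurable g)
    (hμ : IsInvariantMeasure L₀ μ) (hconc : μ (theoryExtent L₀ T₀) = 1) (n : ℕ) :
    MeasurableSpace.comap (restrict L₀ n) inferInstance ≤
      eventuallyMeasurableSpace (MeasurableSpace.comap (restrict L₁ n ∘ g) inferInstance)
        (ae μ) := by
  have := hμ.1
  refine Measurable.comap_le (@measurable_restrict_comp L₀ _ (eventuallyMeasurableSpace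
    (MeasurableSpace.comap (restrict L₁ n ∘ g) inferInstance) (ae μ)) n id ?_)
  intro m φ hφ v hv
  have hψ := Ψ.qf₀ (Fin m) 0 φ hφ
  obtain ⟨_, ⟨A, hA, rfl⟩, hUA⟩ := restrict_realize_formula
    (hg.isInvariantMeasure_map hgm hμ hconc) hψ v hv
  refine ⟨restrict L₁ n ∘ g ⁻¹' A, ⟨A, hA, rfl⟩, Filter.eventuallyEq_set.2 ?_⟩
  filter_upwards [ae_of_ae_map hgm.aemeasurable (Filter.eventuallyEq_set.1 hUA),
    ae_mem_iff_of_measure_eq_one hconc (measurableSet_realize hφ v)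
      (hgm (measurableSet_realize hψ v)) fun S hS => (hg.realize_psi₀ hS φ v).symm]
    with S h1 h2
  exact h2.trans h1

end Interdefinition
end PaperEntropy

open PaperEntropy MeasureTheory
open scoped ENNReal

/-- Quantifier-free interdefinitions between Π₁ theories preserve
invariance, concentration, and the entropy function: if `μ` is an invariant measure
concentrated on `⟦T₀⟧` and `g` realizes the map on structures induced by a
quantifier-free interdefinition `(Ψ₀, Ψ₁)` between `T₀` and `T₁`, then the pushforward
`ν = g_* μ` is an invariant measure concentrated on `⟦T₁⟧` with `Ent(ν) = Ent(μ)`. -/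
theorem interdefinition_preserves_entropy
    (L₀ L₁ : FirstOrder.Language) (T₀ : L₀.Theory) (T₁ : L₁.Theory)
    (hT₀ : IsPi1 L₀ T₀) (hT₁ : IsPi1 L₁ T₁)
    (Ψ : QFInterdefinition L₀ L₁ T₀ T₁)
    (μ : Measure (L₀.Structure ℕ)) (hμ : IsInvariantMeasure L₀ μ)
    (hconc : μ (theoryExtent L₀ T₀) = 1)
    (g : L₀.Structure ℕ → L₁.Structure ℕ) (hgm : Measurable g)
    (hgT : ∀ S ∈ theoryExtent L₀ T₀, g S ∈ theoryExtent L₁ T₁)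
    (hg : ∀ S ∈ theoryExtent L₀ T₀, ∀ (m : ℕ) (φ : L₁.Formula (Fin m)) (v : Fin m → ℕ),
      @FirstOrder.Language.Formula.Realize L₁ ℕ (g S) (Fin m) φ v ↔
      @FirstOrder.Language.Formula.Realize L₀ ℕ S (Fin m) (Ψ.psi₁ (Fin m) 0 φ) v) :
    IsInvariantMeasure L₁ (Measure.map g μ) ∧
    Measure.map g μ (theoryExtent L₁ T₁) = 1 ∧
    ∀ n : ℕ, entFn L₁ (Measure.map g μ) n = entFn L₀ μ n := by
  have := hμ.1
  have hg : Induces Ψ g := hg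
  have hν := hg.isInvariantMeasure_map hgm hμ hconc
  have := hν.1
  refine ⟨hν, le_antisymm prob_le_one ?_, fun n => ?_⟩
  · rw [← hconc]
    exact (measure_mono hgT).trans (Measure.le_map_apply hgm.aemeasurable _)
  · have h₀ := measurable_restrict (L := L₀) n
    have h₁ := measurable_restrict (L := L₁) n
    unfold entFn
    rw [Measure.map_map h₁ hgm]
    exact (entropy_map_eq h₀ (h₁.comp hgm) zeroOneMeasuresAreDirac_finRestriction
      zeroOneMeasuresAreDirac_finRestriction (hg.comap_restrict_comp_le hgm hμ hconc n)
      (hg.comap_restrict_le hgm hμ hconc n)).symm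
end

section
/- Let L₀ be a countable language and μ an invariant measure on Str_{L₀}(ℕ). Then μ(⟦Th_sel(L₀)⟧) = 1; that is, μ-almost every structure interprets every function symbol of L₀ as a selector. -/
open FirstOrder MeasureTheory
open scoped ENNReal

namespace PaperEntropy

open FirstOrder MeasureTheory

/-- The sentence `θ_f` asserting that the function symbol `f` is interpreted as a
selector: `(∀ x₀ … x_{ℓ-1}) ⋁_{i<ℓ} f(x₀,…,x_{ℓ-1}) = x_i`. -/
def selectorSentence (L : FirstOrder.Language) {ℓ : ℕ} (f : L.Functions ℓ) : L.Sentence :=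
  ((List.finRange ℓ).foldr
    (fun i φ =>
      (FirstOrder.Language.Term.bdEqual
        (FirstOrder.Language.Term.func f
          (fun j => FirstOrder.Language.Term.var (Sum.inr j)))
        (FirstOrder.Language.Term.var (Sum.inr i))) ⊔ φ)
    ⊥).alls

/-- The theory `Th_sel(L)` consisting of the selector sentences for all function
symbols of `L`. -/
def ThSel (L : FirstOrder.Language) : L.Theory :=
  { φ | ∃ (ℓ : ℕ) (f : L.Functions ℓ), φ = selectorSentence L f }

end PaperEntropy

namespace PaperEntropy

open FirstOrder MeasureTheory

theorem realize_selectorSentence_iff (L : FirstOrder.Language) {ℓ : ℕ} (f : L.Functions ℓ)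
    (S : L.Structure ℕ) :
    @FirstOrder.Language.Sentence.Realize L ℕ S (selectorSentence L f) ↔
      ∀ v : Fin ℓ → ℕ, ∃ i, S.funMap f v = v i := by
  let := S
  rw [selectorSentence, FirstOrder.Language.Sentence.Realize,
    FirstOrder.Language.BoundedFormula.realize_alls]
  refine forall_congr' fun v => ?_
  rw [← List.foldr_map (g := fun φ ψ => φ ⊔ ψ),
    FirstOrder.Language.BoundedFormula.realize_foldr_sup]
  simp

/-- The event that `f` takes the value `k` at the tuple `v` is measurable. -/
theorem measurableSet_funMap_eq (L : FirstOrder.Language) {ℓ : ℕ} (f : L.Functions ℓ)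
    (v : Fin ℓ → ℕ) (k : ℕ) :
    MeasurableSet {S : L.Structure ℕ | S.funMap f v = k} := by
  refine MeasurableSpace.measurableSet_generateFrom
    ⟨ℓ + 1, FirstOrder.Language.Term.equal
      (FirstOrder.Language.Term.func f fun j => FirstOrder.Language.Term.var j.castSucc)
      (FirstOrder.Language.Term.var (Fin.last ℓ)), ?_, Fin.snoc v k, ?_⟩
  · exact (FirstOrder.Language.BoundedFormula.IsAtomic.equal _ _).isQF
  · ext S
    let := S
    simp [FirstOrder.Language.Formula.realize_equal]

/-- A permutation fixing `v` pointwise preserves the law of the value of `f` at `v`. -/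
theorem IsInvariantMeasure.measure_funMap_eq {L : FirstOrder.Language}
    {μ : Measure (L.Structure ℕ)} (hμ : IsInvariantMeasure L μ) {ℓ : ℕ} (f : L.Functions ℓ)
    {v : Fin ℓ → ℕ} (σ : Equiv.Perm ℕ) (hσ : ∀ i, σ (v i) = v i) (k : ℕ) :
    μ {S | S.funMap f v = σ k} = μ {S | S.funMap f v = k} := by
  have := hμ.1
  have hm : AEMeasurable (logicAction L σ) μ := by
    by_contra h
    exact IsProbabilityMeasure.ne_zero μ ((hμ.2 σ).symm.trans (Measure.map_of_not_aemeasurable h))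
  have hv : (fun i => σ.symm (v i)) = v := funext fun i => by simp [Equiv.symm_apply_eq, hσ]
  calc μ {S | S.funMap f v = σ k}
      = Measure.map (logicAction L σ) μ {S | S.funMap f v = σ k} := by rw [hμ.2 σ]
    _ = μ {S | S.funMap f v = k} := by
      rw [Measure.map_apply_of_aemeasurable hm (measurableSet_funMap_eq L f v _)]
      refine congrArg μ (Set.ext fun S => ?_)
      change σ (S.funMap f fun i => σ.symm (v i)) = σ k ↔ S.funMap f v = k
      rw [hv, σ.apply_eq_iff_eq]

theorem IsInvariantMeasure.measure_funMap_eq_of_notMem_range {L : FirstOrder.Language}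
    {μ : Measure (L.Structure ℕ)} (hμ : IsInvariantMeasure L μ) {ℓ : ℕ} (f : L.Functions ℓ)
    {v : Fin ℓ → ℕ} {k : ℕ} (hk : k ∉ Set.range v) :
    μ {S | S.funMap f v = k} = 0 := by
  have := hμ.1
  have : Infinite ((Set.range v)ᶜ : Set ℕ) := (Set.finite_range v).infinite_compl.to_subtype
  have hconst (j : ((Set.range v)ᶜ : Set ℕ)) :
      μ {S | S.funMap f v = j} = μ {S | S.funMap f v = k} := by
    have hfix (i : Fin ℓ) : Equiv.swap k j.1 (v i) = v i :=
      Equiv.swap_apply_of_ne_of_ne (fun h => hk ⟨i, h⟩) (fun h => j.2 ⟨i, h⟩)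
    simpa using hμ.measure_funMap_eq f (Equiv.swap k j.1) hfix k
  have hsum := tsum_meas_le_meas_iUnion_of_disjoint μ
    (fun j : ((Set.range v)ᶜ : Set ℕ) => measurableSet_funMap_eq L f v j)
    fun i j hij => Set.disjoint_left.2 fun S hi hj => hij (Subtype.ext (hi.symm.trans hj))
  simp only [hconst] at hsum
  by_contra h
  rw [ENNReal.tsum_const_eq_top_of_ne_zero h, top_le_iff] at hsum
  exact measure_ne_top μ _ hsum

end PaperEntropy

open PaperEntropy MeasureTheory

/-- Every invariant measure on `Str_{L₀}(ℕ)` concentrates on structures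
in which every function symbol is interpreted as a selector. -/
theorem invariant_measure_concentrates_on_selectors
    (L₀ : FirstOrder.Language)
    (_ : ∀ m, Countable (L₀.Functions m)) (_ : ∀ m, Countable (L₀.Relations m))
    (μ : Measure (L₀.Structure ℕ)) (hμ : IsInvariantMeasure L₀ μ) :
    μ (theoryExtent L₀ (ThSel L₀)) = 1 := by
  have := hμ.1
  suffices h : ∀ᵐ S ∂μ, S ∈ theoryExtent L₀ (ThSel L₀) from
    (measure_congr (Filter.eventuallyEq_univ.2 h)).trans measure_univ
  have h : ∀ᵐ S ∂μ, ∀ (ℓ : ℕ) (f : L₀.Functions ℓ) (v : Fin ℓ → ℕ) (k : ℕ),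
      k ∉ Set.range v → S.funMap f v ≠ k := by
    simp only [ae_all_iff]
    intro ℓ f v k hk
    simpa [ae_iff] using hμ.measure_funMap_eq_of_notMem_range f hk
  filter_upwards [h] with S hS
  rintro _ ⟨ℓ, f, rfl⟩
  refine (realize_selectorSentence_iff L₀ f S).2 fun v => ?_
  by_contra! hne
  exact hS ℓ f v _ (fun ⟨i, hi⟩ => hne i hi.symm) rfl
end

section
/- Let L₀ be a countable relational language. Then there exist a countable relational language L₁ and a quantifier-free interdefinition between the empty L₀-theory and the Π₁ L₁-theory Th_nr(L₁). -/
open FirstOrder MeasureTheory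
open scoped ENNReal

namespace PaperEntropy

open FirstOrder MeasureTheory

/-- The sentence `(∀ x₀ … x_{m-1}) (R(x₀,…,x_{m-1}) → ⋀_{i<j<m} x_i ≠ x_j)`. -/
def nrSentence (L : FirstOrder.Language) {m : ℕ} (r : L.Relations m) : L.Sentence :=
  ((FirstOrder.Language.Relations.boundedFormula r
      (fun j => FirstOrder.Language.Term.var (Sum.inr j))).imp
    ((((List.finRange m) ×ˢ (List.finRange m)).filter (fun p => p.1 < p.2)).foldr
      (fun p φ =>
        (FirstOrder.Language.Term.bdEqual
            (FirstOrder.Language.Term.var (Sum.inr p.1))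
            (FirstOrder.Language.Term.var (Sum.inr p.2))).not ⊓ φ)
      ⊤)).alls

/-- The Π₁ theory `Th_nr(L)` of non-redundance for a relational language `L`. -/
def ThNR (L : FirstOrder.Language) : L.Theory :=
  { φ | ∃ (m : ℕ) (r : L.Relations m), φ = nrSentence L r }

end PaperEntropy

theorem FirstOrder.Language.Term.mem_varFinsetLeft_var {L : Language} {α β : Type*}
    [DecidableEq α] {x : α ⊕ β} {a : α} :
    a ∈ (var x : L.Term (α ⊕ β)).varFinsetLeft ↔ x = Sum.inl a := by
  rcases x with b | b <;> simp [varFinsetLeft, eq_comm]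

namespace FirstOrder.Language.BoundedFormula

variable {L : Language} {α β : Type*} {n : ℕ}

theorem mem_freeVarFinset_not [DecidableEq α] {φ : L.BoundedFormula α n} {a : α} :
    a ∈ φ.not.freeVarFinset ↔ a ∈ φ.freeVarFinset := by
  simp

theorem mem_freeVarFinset_inf [DecidableEq α] {φ ψ : L.BoundedFormula α n} {a : α} :
    a ∈ (φ ⊓ ψ).freeVarFinset ↔ a ∈ φ.freeVarFinset ∨ a ∈ ψ.freeVarFinset := by
  simp [min, BoundedFormula.not]

theorem mem_freeVarFinset_iSup [DecidableEq α] [Finite β] {f : β → L.BoundedFormula α n} {a : α} :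
    a ∈ (iSup f).freeVarFinset ↔ ∃ b, a ∈ (f b).freeVarFinset := by
  have key (l : List (L.BoundedFormula α n)) :
      a ∈ (l.foldr (· ⊔ ·) ⊥).freeVarFinset ↔ ∃ φ ∈ l, a ∈ φ.freeVarFinset := by
    induction l with
    | nil => simp [Bot.bot]
    | cons φ l ih => simp [max, ← ih]
  simp [iSup, key]

theorem mem_freeVarFinset_iInf [DecidableEq α] [Finite β] {f : β → L.BoundedFormula α n} {a : α} :
    a ∈ (iInf f).freeVarFinset ↔ ∃ b, a ∈ (f b).freeVarFinset := by
  have key (l : List (L.BoundedFormula α n)) :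
      a ∈ (l.foldr (· ⊓ ·) ⊤).freeVarFinset ↔ ∃ φ ∈ l, a ∈ φ.freeVarFinset := by
    induction l with
    | nil => simp [Top.top, BoundedFormula.not, Bot.bot]
    | cons φ l ih => simp [mem_freeVarFinset_inf, ih]
  simp [iInf, key]

theorem IsQF.iSup [Finite β] {f : β → L.BoundedFormula α n} (h : ∀ b, (f b).IsQF) :
    (BoundedFormula.iSup f).IsQF := by
  have key (l : List β) : ((l.map f).foldr (· ⊔ ·) ⊥).IsQF := by
    induction l with
    | nil => exact isQF_bot
    | cons b l ih => exact (h b).sup ih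
  exact key _

theorem IsQF.iInf [Finite β] {f : β → L.BoundedFormula α n} (h : ∀ b, (f b).IsQF) :
    (BoundedFormula.iInf f).IsQF := by
  have key (l : List β) : ((l.map f).foldr (· ⊓ ·) ⊤).IsQF := by
    induction l with
    | nil => exact IsQF.top
    | cons b l ih => exact (h b).inf ih
  exact key _

end FirstOrder.Language.BoundedFormula

namespace PaperEntropy

open FirstOrder.Language FirstOrder.Language.BoundedFormula

section Translation

universe u v u' v' w

/-- The variable that a term of a relational language consists of. -/
def termVar {L : FirstOrder.Language.{u, v}} [L.IsRelational] {α : Type*} : L.Term α → α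
  | .var a => a
  | .func f _ => isEmptyElim f

@[simp]
theorem var_termVar {L : FirstOrder.Language.{u, v}} [L.IsRelational] {α : Type*} (t : L.Term α) :
    Term.var (termVar t) = t := by
  cases t with
  | var a => rfl
  | func f _ => exact isEmptyElim f

theorem realize_eq_termVar {L : FirstOrder.Language.{u, v}} [L.IsRelational] {α M : Type*}
    [L.Structure M] (t : L.Term α) (x : α → M) : t.realize x = x (termVar t) := by
  cases t with
  | var a => rfl
  | func f _ => exact isEmptyElim f

theorem mem_varFinsetLeft_iff {L : FirstOrder.Language.{u, v}} [L.IsRelational] {α β : Type*}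
    [DecidableEq α] (t : L.Term (α ⊕ β)) (a : α) :
    a ∈ t.varFinsetLeft ↔ termVar t = Sum.inl a := by
  rw [← Term.mem_varFinsetLeft_var (L := L), var_termVar]

/-- A quantifier-free translation of the atomic relations of `L` into `L'`, using exactly the
same variables. -/
structure AtomTranslation (L : FirstOrder.Language.{u, v}) (L' : FirstOrder.Language.{u', v'}) where
  toFormula : ∀ {k : ℕ} (_ : L.Relations k) {α : Type} {n : ℕ} (_ : Fin k → α ⊕ Fin n),
    L'.BoundedFormula α n
  isQF : ∀ {k : ℕ} (R : L.Relations k) {α : Type} {n : ℕ} (x : Fin k → α ⊕ Fin n),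
    (toFormula R x).IsQF
  mem_freeVarFinset : ∀ {k : ℕ} (R : L.Relations k) {α : Type} [DecidableEq α] {n : ℕ}
    (x : Fin k → α ⊕ Fin n) (a : α), a ∈ (toFormula R x).freeVarFinset ↔ ∃ i, x i = Sum.inl a

namespace AtomTranslation

variable {L : FirstOrder.Language.{u, v}} {L' : FirstOrder.Language.{u', v'}} [L.IsRelational]
  (F : AtomTranslation L L')

/-- Extend a translation of the atomic relations to all formulas. -/
def map {α : Type} : ∀ {n : ℕ}, L.BoundedFormula α n → L'.BoundedFormula α n
  | _, .falsum => .falsum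
  | _, .equal t₁ t₂ => .equal (.var (termVar t₁)) (.var (termVar t₂))
  | _, .rel R ts => F.toFormula R fun i => termVar (ts i)
  | _, .imp φ ψ => .imp (map φ) (map ψ)
  | _, .all φ => .all (map φ)

theorem isQF_map {α : Type} {n : ℕ} {φ : L.BoundedFormula α n} (h : φ.IsQF) : (F.map φ).IsQF := by
  induction h with
  | falsum => exact .falsum
  | of_isAtomic h =>
    cases h with
    | equal t₁ t₂ => exact (IsAtomic.equal _ _).isQF
    | rel R ts => exact F.isQF R _
  | imp _ _ ih₁ ih₂ => exact ih₁.imp ih₂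

theorem freeVarFinset_map {α : Type} [DecidableEq α] {n : ℕ} (φ : L.BoundedFormula α n) :
    (F.map φ).freeVarFinset = φ.freeVarFinset := by
  induction φ with
  | falsum => rfl
  | equal t₁ t₂ =>
    have {k : ℕ} (t : L.Term (α ⊕ Fin k)) :
        (Term.var (termVar t) : L'.Term _).varFinsetLeft = t.varFinsetLeft := by
      ext a
      rw [Term.mem_varFinsetLeft_var, mem_varFinsetLeft_iff]
    simp [map, this]
  | rel R ts =>
    ext a
    simp [map, F.mem_freeVarFinset, mem_varFinsetLeft_iff]
  | imp _ _ ih₁ ih₂ => simp [map, ih₁, ih₂]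
  | all _ ih => simp [map, ih]

theorem realize_map {M : Type*} [L.Structure M] [L'.Structure M]
    (h : ∀ {k : ℕ} (R : L.Relations k) {α : Type} {n : ℕ} (x : Fin k → α ⊕ Fin n) (v : α → M)
      (xs : Fin n → M),
      (F.toFormula R x).Realize v xs ↔ Structure.RelMap R fun i => Sum.elim v xs (x i))
    {α : Type} {n : ℕ} (φ : L.BoundedFormula α n) (v : α → M) (xs : Fin n → M) :
    (F.map φ).Realize v xs ↔ φ.Realize v xs := by
  induction φ with
  | falsum => rfl
  | equal t₁ t₂ => simp [map, BoundedFormula.Realize, realize_eq_termVar]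
  | rel R ts => simp [map, BoundedFormula.Realize, realize_eq_termVar, h]
  | imp _ _ ih₁ ih₂ => simp [map, BoundedFormula.Realize, ih₁, ih₂]
  | all _ ih => simp [map, BoundedFormula.Realize, ih]

end AtomTranslation

theorem iff_of_realize {L : FirstOrder.Language.{u, v}} {T : L.Theory} {α : Type w} {n : ℕ}
    {φ ψ : L.BoundedFormula α n}
    (h : ∀ (M : Type (max u v w)) [L.Structure M], M ⊨ T → ∀ (v : α → M) (xs : Fin n → M),
      φ.Realize v xs ↔ ψ.Realize v xs) :
    FirstOrder.Language.Theory.Iff T φ ψ := fun M v xs =>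
  realize_iff.2 (h M M.is_model v xs)

end Translation

section NonRedundantLanguage

universe u v

theorem injective_of_relMap {L : FirstOrder.Language.{u, v}} {M : Type*} [L.Structure M]
    (hM : M ⊨ ThNR L) {m : ℕ} (r : L.Relations m) (x : Fin m → M) (hx : Structure.RelMap r x) :
    Function.Injective x := by
  have h : M ⊨ nrSentence L r := hM.realize_of_mem _ ⟨m, r, rfl⟩
  have key (l : List (Fin m × Fin m)) :
      (l.foldr (fun p φ => (Term.bdEqual (Term.var (Sum.inr p.1))
        (Term.var (Sum.inr p.2))).not ⊓ φ) (⊤ : L.BoundedFormula Empty m)).Realize default x →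
        ∀ p ∈ l, x p.1 ≠ x p.2 := by
    induction l with
    | nil => simp
    | cons p l ih =>
      simp only [List.foldr_cons, realize_inf, realize_not, realize_bdEqual, Term.realize_var,
        Sum.elim_inr, List.mem_cons, forall_eq_or_imp]
      exact fun h => ⟨h.1, ih h.2⟩
  have hlt : ∀ i j, i < j → x i ≠ x j := fun i j hij =>
    key _ (realize_imp.1 (realize_alls.1 h x) hx) (i, j)
      (by simpa [List.mem_product, List.mem_filter] using hij)
  intro i j hij
  by_contra hne
  rcases lt_or_gt_of_ne hne with hl | hl
  · exact hlt i j hl hij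
  · exact hlt j i hl hij.symm

instance finite_setoid (α : Type*) [Finite α] : Finite (Setoid α) :=
  Finite.of_injective (fun s : Setoid α => s.r) fun _ _ h =>
    Setoid.ext fun a b => iff_of_eq (congrFun (congrFun h a) b)

variable (L : FirstOrder.Language.{u, v})

/-- The language with a `k`-ary relation for every relation symbol of `L` together with a partition
of its arguments into `k` classes. -/
def nrLanguage [∀ m, Countable (L.Relations m)] : FirstOrder.Language.{0, 0} where
  Functions _ := Empty
  Relations k := Σ m : ℕ, Shrink.{0} (L.Relations m) ×
    {s : Setoid (Fin m) // Nat.card (Quotient s) = k}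

variable [∀ m, Countable (L.Relations m)]

instance : (nrLanguage L).IsRelational := fun _ => inferInstanceAs (IsEmpty Empty)

instance (k : ℕ) : Countable ((nrLanguage L).Relations k) := by
  have (m : ℕ) : Countable (Shrink.{0} (L.Relations m)) :=
    (equivShrink.{0} (L.Relations m)).symm.injective.countable
  exact inferInstanceAs (Countable (Σ m : ℕ, Shrink.{0} (L.Relations m) ×
    {s : Setoid (Fin m) // Nat.card (Quotient s) = k}))

variable {L} in
/-- The relation symbol given by `R` and the partition `s` of its arguments. -/
noncomputable def relOfPartition {m : ℕ} (R : L.Relations m) (s : Setoid (Fin m)) :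
    (nrLanguage L).Relations (Nat.card (Quotient s)) :=
  ⟨m, equivShrink _ R, s, rfl⟩

variable {L} in
/-- The class, as an argument of `r`, of an argument of the symbol of `L` underlying `r`. -/
noncomputable def classIndex {k : ℕ} (r : (nrLanguage L).Relations k) (i : Fin r.1) : Fin k :=
  Finite.equivFinOfCardEq r.2.2.2 (Quotient.mk r.2.2.1 i)

variable {L} in
/-- A representative of each class of the partition of `r`. -/
noncomputable def classRep {k : ℕ} (r : (nrLanguage L).Relations k) (j : Fin k) : Fin r.1 :=
  ((Finite.equivFinOfCardEq r.2.2.2).symm j).out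

@[simp]
theorem classIndex_classRep {k : ℕ} (r : (nrLanguage L).Relations k) (j : Fin k) :
    classIndex r (classRep r j) = j := by
  simp [classIndex, classRep]

theorem classIndex_eq_iff {k : ℕ} (r : (nrLanguage L).Relations k) (i j : Fin r.1) :
    classIndex r i = classIndex r j ↔ r.2.2.1 i j := by
  simp only [classIndex, EmbeddingLike.apply_eq_iff_eq, Quotient.eq]

variable {L} in
/-- Collapse an argument to the representative of its class. -/
noncomputable def collapse {m : ℕ} (R : L.Relations m) (s : Setoid (Fin m)) (i : Fin m) : Fin m :=
  classRep (relOfPartition R s) (classIndex (relOfPartition R s) i)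

/-- Split an atomic relation of `L` according to the equalities between its arguments. -/
noncomputable def splitAtoms : AtomTranslation L (nrLanguage L) where
  toFormula {m} R {_ _} x := BoundedFormula.iSup fun s : Setoid (Fin m) =>
    (BoundedFormula.iInf fun i => (Term.var (x i)).bdEqual (Term.var (x (collapse R s i)))) ⊓
      BoundedFormula.rel (relOfPartition R s)
        fun j => Term.var (x (classRep (relOfPartition R s) j))
  isQF {_} R {_ _} x := IsQF.iSup fun s =>
    (IsQF.iInf fun i => (IsAtomic.equal _ _).isQF).inf (IsAtomic.rel _ _).isQF
  mem_freeVarFinset {m} R {_ _ _} x a := by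
    simp only [mem_freeVarFinset_iSup, mem_freeVarFinset_inf, mem_freeVarFinset_iInf, Term.bdEqual,
      freeVarFinset, Finset.mem_union, Finset.mem_biUnion, Finset.mem_univ, true_and,
      Term.mem_varFinsetLeft_var]
    constructor
    · rintro ⟨s, ⟨i, h | h⟩ | ⟨j, h⟩⟩ <;> exact ⟨_, h⟩
    · rintro ⟨i, h⟩
      exact ⟨⊥, Or.inl ⟨i, Or.inl h⟩⟩

/-- Express an atomic relation of the non-redundant language in `L`. -/
noncomputable def mergeAtoms : AtomTranslation (nrLanguage L) L where
  toFormula {k} r {_ _} x :=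
    (BoundedFormula.iInf fun p : {p : Fin k × Fin k // p.1 ≠ p.2} =>
      ((Term.var (x p.1.1)).bdEqual (Term.var (x p.1.2))).not) ⊓
      BoundedFormula.rel ((equivShrink _).symm r.2.1) fun i => Term.var (x (classIndex r i))
  isQF {_} r {_ _} x :=
    (IsQF.iInf fun i => (IsAtomic.equal _ _).isQF.not).inf (IsAtomic.rel _ _).isQF
  mem_freeVarFinset {k} r {_ _ _} x a := by
    simp only [mem_freeVarFinset_inf, mem_freeVarFinset_iInf, mem_freeVarFinset_not]
    simp only [Term.bdEqual, freeVarFinset, Finset.mem_union, Finset.mem_biUnion, Finset.mem_univ,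
      true_and, Term.mem_varFinsetLeft_var]
    constructor
    · rintro (⟨p, h | h⟩ | ⟨j, h⟩) <;> exact ⟨_, h⟩
    · rintro ⟨j, h⟩
      exact Or.inr ⟨classRep r j, by simpa using h⟩

/-- The non-redundant structure defined from an `L`-structure. -/
noncomputable abbrev toNR (M : Type*) [L.Structure M] : (nrLanguage L).Structure M where
  RelMap r x := Function.Injective x ∧
    Structure.RelMap ((equivShrink _).symm r.2.1 : L.Relations r.1) fun i => x (classIndex r i)

/-- The `L`-structure defined from a structure in the non-redundant language. -/
noncomputable abbrev ofNR [L.IsRelational] (M : Type*) [(nrLanguage L).Structure M] :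
    L.Structure M where
  RelMap {m} R x := ∃ s : Setoid (Fin m), (∀ i, x i = x (collapse R s i)) ∧
    Structure.RelMap (relOfPartition R s) fun j => x (classRep (relOfPartition R s) j)

theorem ofNR_toNR [L.IsRelational] (M : Type*) [S : L.Structure M] :
    @ofNR L _ _ M (toNR L M) = S := by
  ext m R x
  · exact isEmptyElim R
  · change (∃ s : Setoid (Fin m), (∀ i, x i = x (collapse R s i)) ∧
      Function.Injective (fun j => x (classRep (relOfPartition R s) j)) ∧
      Structure.RelMap ((equivShrink.{0} (L.Relations m)).symm (equivShrink _ R))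
        fun i => x (collapse R s i)) ↔ S.RelMap R x
    simp only [Equiv.symm_apply_apply]
    constructor
    · rintro ⟨s, h, -, hR⟩
      simpa only [← h] using hR
    · intro hR
      have key (i : Fin m) : x i = x (collapse R (Setoid.ker x) i) :=
        (((classIndex_eq_iff L (relOfPartition R (Setoid.ker x)) _ i).1
          (classIndex_classRep L _ _) : x _ = x i)).symm
      refine ⟨Setoid.ker x, key, fun j j' h => ?_, by simpa only [← key] using hR⟩
      rw [← classIndex_classRep L (relOfPartition R (Setoid.ker x)) j,
        ← classIndex_classRep L (relOfPartition R (Setoid.ker x)) j', classIndex_eq_iff]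
      exact h

theorem relMap_relOfPartition {M : Type*} [(nrLanguage L).Structure M] {k : ℕ}
    (r : (nrLanguage L).Relations k) (x : Fin k → M) :
    Structure.RelMap (relOfPartition ((equivShrink.{0} (L.Relations r.1)).symm r.2.1) r.2.2.1)
      (fun j => x (classIndex r (classRep
        (relOfPartition ((equivShrink.{0} (L.Relations r.1)).symm r.2.1) r.2.2.1) j))) ↔
      Structure.RelMap r x := by
  obtain ⟨m, R, s, rfl⟩ := r
  have : relOfPartition ((equivShrink.{0} (L.Relations m)).symm R) s = ⟨m, R, s, rfl⟩ := by
    simp only [relOfPartition, Equiv.apply_symm_apply]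
    rfl
  exact iff_of_eq (congrArg₂ Structure.RelMap this (funext fun j =>
    congrArg x (classIndex_classRep L ⟨m, R, s, rfl⟩ j)))

theorem toNR_ofNR [L.IsRelational] (M : Type*) [S : (nrLanguage L).Structure M]
    (hM : M ⊨ ThNR (nrLanguage L)) : @toNR L _ M (ofNR L M) = S := by
  ext k r x
  · exact isEmptyElim r
  · let R : L.Relations r.1 := (equivShrink.{0} (L.Relations r.1)).symm r.2.1
    change (Function.Injective x ∧ ∃ s' : Setoid (Fin r.1),
      (∀ i, x (classIndex r i) = x (classIndex r (collapse R s' i))) ∧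
      Structure.RelMap (relOfPartition R s')
        fun j => x (classIndex r (classRep (relOfPartition R s') j))) ↔ Structure.RelMap r x
    constructor
    · rintro ⟨hx, s', h, hR⟩
      have hinj := injective_of_relMap hM _ _ hR
      suffices s' = r.2.2.1 by
        subst this
        exact (relMap_relOfPartition L r x).1 hR
      ext i j
      rw [← classIndex_eq_iff, hx.eq_iff.symm, h i, h j]
      refine Iff.trans ?_ hinj.eq_iff.symm
      exact (classIndex_eq_iff L (relOfPartition R s') i j).symm
    · intro hR
      refine ⟨injective_of_relMap hM _ _ hR, r.2.2.1, fun i => congrArg x ?_,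
        (relMap_relOfPartition L r x).2 hR⟩
      rw [classIndex_eq_iff]
      exact (classIndex_eq_iff L (relOfPartition R r.2.2.1) i _).1
        (classIndex_classRep L _ _).symm

theorem realize_splitAtoms [L.IsRelational] {M : Type*} [(nrLanguage L).Structure M] {α : Type}
    {n : ℕ} (φ : L.BoundedFormula α n) (v : α → M) (xs : Fin n → M) :
    ((splitAtoms L).map φ).Realize v xs ↔ @BoundedFormula.Realize L M (ofNR L M) _ _ φ v xs := by
  let _ := ofNR L M
  refine AtomTranslation.realize_map _ (fun {_} R {_ _} x v xs => ?_) φ v xs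
  simp only [splitAtoms, realize_iSup, realize_inf, realize_iInf, realize_bdEqual,
    Term.realize_var]
  rfl

theorem realize_mergeAtoms {M : Type*} [L.Structure M] {α : Type}
    {n : ℕ} (φ : (nrLanguage L).BoundedFormula α n) (v : α → M) (xs : Fin n → M) :
    ((mergeAtoms L).map φ).Realize v xs ↔
      @BoundedFormula.Realize (nrLanguage L) M (toNR L M) _ _ φ v xs := by
  let _ := toNR L M
  refine AtomTranslation.realize_map _ (fun {k} r {_ _} x v xs => ?_) φ v xs
  simp only [mergeAtoms, realize_inf, realize_iInf, realize_not, realize_bdEqual,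
    Term.realize_var]
  refine and_congr ⟨fun h i j hij => ?_, fun h p hp => p.2 (h hp)⟩ Iff.rfl
  by_contra hne
  exact h ⟨(i, j), hne⟩ hij

/-- The interdefinition of the empty theory with the theory of non-redundance. -/
noncomputable def nrInterdefinition [L.IsRelational] :
    QFInterdefinition L (nrLanguage L) ∅ (ThNR (nrLanguage L)) where
  psi₀ _ _ := (splitAtoms L).map
  psi₁ _ _ := (mergeAtoms L).map
  qf₀ _ _ _ := (splitAtoms L).isQF_map
  qf₁ _ _ _ := (mergeAtoms L).isQF_map
  freeVar₀ _ _ _ := (splitAtoms L).freeVarFinset_map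
  freeVar₁ _ _ _ := (mergeAtoms L).freeVarFinset_map
  comp₀ _ _ ρ := iff_of_realize fun M _ hM v xs => by
    let _ := ofNR L M
    rw [realize_splitAtoms, realize_mergeAtoms, toNR_ofNR L M hM]
  comp₁ _ _ ρ := iff_of_realize fun M _ _ v xs => by
    let _ := toNR L M
    rw [realize_mergeAtoms, realize_splitAtoms, ofNR_toNR]
  eq₀ _ _ _ _ := .refl _
  eq₁ _ _ _ _ := .refl _
  not₀ _ _ _ := .refl _
  not₁ _ _ _ := .refl _
  inf₀ _ _ _ _ := .refl _
  inf₁ _ _ _ _ := .refl _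
  ex₀ _ _ _ := .refl _
  ex₁ _ _ _ := .refl _

end NonRedundantLanguage

end PaperEntropy

open PaperEntropy MeasureTheory

/-- For every countable relational language `L₀` there are a countable
relational language `L₁` and a quantifier-free interdefinition between the empty
`L₀`-theory and the Π₁ `L₁`-theory `Th_nr(L₁)`. -/
theorem interdefinition_to_nonredundant
    (L₀ : FirstOrder.Language) (_ : L₀.IsRelational)
    (_ : ∀ m, Countable (L₀.Relations m)) :
    ∃ L₁ : FirstOrder.Language.{0, 0}, L₁.IsRelational ∧
      (∀ m, Countable (L₁.Relations m)) ∧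
      Nonempty (QFInterdefinition L₀ L₁ (∅ : L₀.Theory) (ThNR L₁)) := by
  exact ⟨nrLanguage L₀, inferInstance, inferInstance, ⟨nrInterdefinition L₀⟩⟩
end

section
/- Let L be a countable relational language all of whose relation symbols are unary, and let μ be a non-redundant invariant measure on Str_L(ℕ) with Ent(μ)(n) = o(n). Then Ent(μ) is constant on positive integers: there is c ∈ ℝ ∪ {∞} with Ent(μ)(n) = c for all n ≥ 1. -/
open FirstOrder MeasureTheory
open scoped ENNReal

namespace PaperEntropy

theorem entropy_map_of_injective {α β : Type*} [MeasurableSpace α] [MeasurableSpace β]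
    [MeasurableSingletonClass β] (ν : Measure α) {d : α → β} (hd : Measurable d)
    (hinj : Function.Injective d) : entropy (Measure.map d ν) = entropy ν := by
  have hval (a : α) : Measure.map d ν {d a} = ν {a} := by
    rw [Measure.map_apply hd (measurableSet_singleton _), ← Set.image_singleton,
      hinj.preimage_image]
  have hsum (g : ℝ≥0∞ → ℝ≥0∞) (hg : g 0 = 0) :
      ∑' b, g (Measure.map d ν {b}) = ∑' a, g (ν {a}) := by
    rw [← hinj.tsum_eq (f := fun b => g (Measure.map d ν {b}))]
    · simp only [hval]
    · intro b hb
      by_contra hb'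
      apply hb
      have : d ⁻¹' {b} = ∅ := by
        ext a
        simp only [Set.mem_preimage, Set.mem_singleton_iff, Set.mem_empty_iff_false, iff_false]
        exact fun h => hb' ⟨a, h⟩
      simp [Measure.map_apply hd (measurableSet_singleton b), this, hg]
  unfold entropy
  rw [hsum (fun x => x) rfl, Measure.map_apply hd MeasurableSet.univ, Set.preimage_univ,
    hsum (fun x => ENNReal.ofReal (-(x.toReal * Real.logb 2 x.toReal))) (by simp)]

theorem mul_neg_logb_add_le {p q m : ℝ≥0∞} (hp : p ≤ 1) (hmq : m ≤ q) (hmqp : m + q ≤ p) :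
    q * ENNReal.ofReal (-Real.logb 2 p.toReal) + ENNReal.ofReal (1 / 2) * m ≤
      ENNReal.ofReal (-(q.toReal * Real.logb 2 q.toReal)) := by
  have hp' : p ≠ ⊤ := ne_top_of_le_ne_top ENNReal.one_ne_top hp
  have hq' : q ≠ ⊤ := ne_top_of_le_ne_top hp' (le_add_self.trans hmqp)
  have hm' : m ≠ ⊤ := ne_top_of_le_ne_top hq' hmq
  have hp1 : p.toReal ≤ 1 := by simpa using ENNReal.toReal_mono ENNReal.one_ne_top hp
  have hmq1 := ENNReal.toReal_mono hq' hmq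
  have hmqp1 := ENNReal.toReal_mono hp' hmqp
  rw [ENNReal.toReal_add hm' hq'] at hmqp1
  have hm0 : 0 ≤ m.toReal := ENNReal.toReal_nonneg
  have hq0 : 0 ≤ q.toReal := ENNReal.toReal_nonneg
  have hp0 : 0 ≤ p.toReal := ENNReal.toReal_nonneg
  have hlp : 0 ≤ -Real.logb 2 p.toReal := by
    have := Real.logb_nonpos (b := 2) (by norm_num) hp0 hp1
    linarith
  rw [← ENNReal.ofReal_toReal hq', ← ENNReal.ofReal_toReal hm', ENNReal.toReal_ofReal hq0,
    ← ENNReal.ofReal_mul hq0, ← ENNReal.ofReal_mul (by norm_num),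
    ← ENNReal.ofReal_add (by positivity) (by positivity)]
  apply ENNReal.ofReal_le_ofReal
  generalize p.toReal = p at *
  generalize q.toReal = q at *
  generalize m.toReal = m at *
  rcases hq0.eq_or_lt with rfl | hq
  · have : m = 0 := le_antisymm hmq1 hm0
    simp [this]
  have hpp : 0 < p := by linarith
  have hlog : 1 - q / p ≤ Real.log p - Real.log q := by
    have := Real.one_sub_inv_le_log_of_pos (div_pos hpp hq)
    rwa [inv_div, Real.log_div hpp.ne' hq.ne'] at this
  have hm : m / 2 ≤ q * (1 - q / p) := by
    rw [one_sub_div hpp.ne', mul_div_assoc', div_le_div_iff₀ (by norm_num) hpp]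
    rcases le_total (2 * q) p with h | h <;> nlinarith
  have hl0 : 0 < Real.log 2 := Real.log_pos (by norm_num)
  have hl1 : Real.log 2 ≤ 1 := by have := Real.log_two_lt_d9; linarith
  have hqlog : m / 2 ≤ q * (Real.log p - Real.log q) :=
    hm.trans (mul_le_mul_of_nonneg_left hlog hq.le)
  have : m / 2 ≤ q * (Real.logb 2 p - Real.logb 2 q) := by
    unfold Real.logb
    rw [← sub_div, mul_div_assoc', le_div_iff₀ hl0]
    nlinarith
  linarith

/-- A random variable `Z` with purely atomic law decomposes any event into its atoms. -/
theorem measure_le_tsum_inter_preimage {Ω B : Type*} [MeasurableSpace Ω] [MeasurableSpace B]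
    [MeasurableSingletonClass B] (μ : Measure Ω) [IsProbabilityMeasure μ] {Z : Ω → B}
    (hZ : Measurable Z) (hat : ∑' z, μ (Z ⁻¹' {z}) = 1) (S : Set Ω) :
    μ S ≤ ∑' z, μ (S ∩ Z ⁻¹' {z}) := by
  set C : Set B := Function.support fun z => μ (Z ⁻¹' {z})
  have hC : C.Countable := Summable.countable_support_ennreal (by rw [hat]; simp)
  have : Countable C := hC
  have hCm : MeasurableSet (Z ⁻¹' C) := hZ hC.measurableSet
  have hμC : μ (Z ⁻¹' C) = 1 := by
    rw [← hat, ← tsum_subtype_support (fun z => μ (Z ⁻¹' {z})),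
      ← tsum_measure_preimage_singleton hC (fun y _ => hZ (measurableSet_singleton y))]
  have hμC' : μ (Z ⁻¹' C)ᶜ = 0 := (prob_compl_eq_zero_iff hCm).2 hμC
  calc μ S ≤ μ (⋃ z : C, S ∩ Z ⁻¹' {z.1}) + μ (Z ⁻¹' C)ᶜ := by
        refine (measure_mono fun ω hω => ?_).trans (measure_union_le _ _)
        by_cases h : Z ω ∈ C
        · exact Or.inl (Set.mem_iUnion.2 ⟨⟨Z ω, h⟩, hω, rfl⟩)
        · exact Or.inr h
    _ ≤ ∑' z : C, μ (S ∩ Z ⁻¹' {z.1}) := by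
        rw [hμC', add_zero]
        exact measure_iUnion_le _
    _ ≤ ∑' z, μ (S ∩ Z ⁻¹' {z}) :=
        ENNReal.tsum_comp_le_tsum_of_injective Subtype.val_injective _

theorem tsum_measure_inter_preimage_le {Ω B : Type*} [MeasurableSpace Ω] [MeasurableSpace B]
    [MeasurableSingletonClass B] (μ : Measure Ω) {Z : Ω → B} (hZ : Measurable Z)
    {S : Set Ω} (hS : MeasurableSet S) : ∑' z, μ (S ∩ Z ⁻¹' {z}) ≤ μ S := by
  refine (tsum_meas_le_meas_iUnion_of_disjoint μ
    (fun z => hS.inter (hZ (measurableSet_singleton z))) fun z z' hzz' => ?_).trans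
    (measure_mono (Set.iUnion_subset fun z => Set.inter_subset_left))
  exact Set.disjoint_left.2 fun ω h h' => hzz' (h.2.symm.trans h'.2)

/-- If `X` and `Y` have the same joint law with `W`, adjoining `X` to `W` increases the entropy
by at least half the probability that `X` and `Y` differ. -/
theorem entropy_add_half_measure_ne_le {Ω A E : Type*} [MeasurableSpace Ω] [MeasurableSpace A]
    [MeasurableSpace E] [MeasurableSingletonClass A] [MeasurableSingletonClass E]
    (μ : Measure Ω) [IsProbabilityMeasure μ] {W : Ω → A} {X Y : Ω → E} (hW : Measurable W)
    (hX : Measurable X) (hY : Measurable Y)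
    (hXY : Measure.map (fun ω => (W ω, X ω)) μ = Measure.map (fun ω => (W ω, Y ω)) μ) :
    entropy (Measure.map W μ) + ENNReal.ofReal (1 / 2) * μ {ω | X ω ≠ Y ω} ≤
      entropy (Measure.map (fun ω => (W ω, X ω)) μ) := by
  set Z : Ω → A × E := fun ω => (W ω, X ω) with hZdef
  have hZ : Measurable Z := hW.prodMk hX
  have hWY : Measurable fun ω => (W ω, Y ω) := hW.prodMk hY
  have hWs (w : A) : MeasurableSet (W ⁻¹' {w}) := hW (measurableSet_singleton w)
  have hmapZ (z : A × E) : Measure.map Z μ {z} = μ (Z ⁻¹' {z}) :=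
    Measure.map_apply hZ (measurableSet_singleton z)
  have hmapW (w : A) : Measure.map W μ {w} = μ (W ⁻¹' {w}) :=
    Measure.map_apply hW (measurableSet_singleton w)
  by_cases hat : ∑' z, μ (Z ⁻¹' {z}) = 1
  swap
  · have : entropy (Measure.map Z μ) = ⊤ := by
      unfold entropy
      rw [if_neg]
      simpa only [hmapZ, Measure.map_apply hZ MeasurableSet.univ, Set.preimage_univ,
        measure_univ] using hat
    rw [this]
    exact le_top
  have hfib (w : A) (a : E) : W ⁻¹' {w} ∩ X ⁻¹' {a} = Z ⁻¹' {(w, a)} := by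
    ext ω
    simp [hZdef]
  have hatW : ∑' w, μ (W ⁻¹' {w}) = 1 := by
    apply le_antisymm
    · simpa using tsum_measure_inter_preimage_le μ hW MeasurableSet.univ
    · rw [← hat, ENNReal.tsum_prod']
      refine ENNReal.tsum_le_tsum fun w => ?_
      simpa only [hfib] using tsum_measure_inter_preimage_le μ hX (hWs w)
  have hp (w : A) : μ (W ⁻¹' {w}) ≤ ∑' a, μ (Z ⁻¹' {(w, a)}) := by
    refine (measure_le_tsum_inter_preimage μ hZ hat _).trans ?_
    rw [ENNReal.tsum_prod', tsum_eq_single w]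
    · exact ENNReal.tsum_le_tsum fun a => measure_mono Set.inter_subset_right
    · intro w' hw'
      refine ENNReal.tsum_eq_zero.2 fun a => ?_
      convert measure_empty (μ := μ)
      refine Set.eq_empty_of_forall_notMem fun ω hω => hw' ?_
      have h2 : Z ω = (w', a) := hω.2
      exact (congrArg Prod.fst h2).symm.trans hω.1
  have hpoint (w : A) (a : E) :
      μ (Z ⁻¹' {(w, a)}) * ENNReal.ofReal (-Real.logb 2 (μ (W ⁻¹' {w})).toReal) +
        ENNReal.ofReal (1 / 2) * μ ({ω | X ω ≠ Y ω} ∩ Z ⁻¹' {(w, a)}) ≤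
      ENNReal.ofReal (-((μ (Z ⁻¹' {(w, a)})).toReal *
        Real.logb 2 (μ (Z ⁻¹' {(w, a)})).toReal)) := by
    refine mul_neg_logb_add_le prob_le_one (measure_mono Set.inter_subset_right) ?_
    have hq : μ (Z ⁻¹' {(w, a)}) = μ ((fun ω => (W ω, Y ω)) ⁻¹' {(w, a)}) := by
      rw [← hmapZ, hXY, Measure.map_apply hWY (measurableSet_singleton _)]
    rw [hq, ← measure_union _ (hWY (measurableSet_singleton _))]
    · refine measure_mono ?_
      rintro ω (⟨-, h⟩ | h)
      · exact congrArg Prod.fst (show (W ω, X ω) = (w, a) from h)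
      · exact congrArg Prod.fst (show (W ω, Y ω) = (w, a) from h)
    · refine Set.disjoint_left.2 fun ω h h' => h.1 ?_
      exact (congrArg Prod.snd (show (W ω, X ω) = (w, a) from h.2)).trans
        (congrArg Prod.snd (show (W ω, Y ω) = (w, a) from h')).symm
  have hlp (w : A) : 0 ≤ -Real.logb 2 (μ (W ⁻¹' {w})).toReal := by
    have := Real.logb_nonpos (b := 2) (by norm_num)
      (ENNReal.toReal_nonneg (a := μ (W ⁻¹' {w})))
      (by simpa using ENNReal.toReal_mono ENNReal.one_ne_top (prob_le_one (μ := μ)))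
    linarith
  unfold entropy
  simp only [hmapZ, hmapW, Measure.map_apply hZ MeasurableSet.univ,
    Measure.map_apply hW MeasurableSet.univ, Set.preimage_univ, measure_univ, hat, hatW, if_true]
  calc _ ≤ ∑' w, ∑' a, μ (Z ⁻¹' {(w, a)}) *
            ENNReal.ofReal (-Real.logb 2 (μ (W ⁻¹' {w})).toReal) +
          ENNReal.ofReal (1 / 2) *
            ∑' w, ∑' a, μ ({ω | X ω ≠ Y ω} ∩ Z ⁻¹' {(w, a)}) := by
        refine add_le_add (ENNReal.tsum_le_tsum fun w => ?_) ?_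
        · rw [ENNReal.tsum_mul_right, ← mul_neg, ENNReal.ofReal_mul ENNReal.toReal_nonneg,
            ENNReal.ofReal_toReal (measure_ne_top μ _)]
          gcongr
          exact hp w
        · rw [← ENNReal.tsum_prod (f := fun w a => μ ({ω | X ω ≠ Y ω} ∩ Z ⁻¹' {(w, a)}))]
          gcongr
          exact measure_le_tsum_inter_preimage μ hZ hat _
    _ ≤ _ := by
        rw [ENNReal.tsum_prod', ← ENNReal.tsum_mul_left, ← ENNReal.tsum_add]
        refine ENNReal.tsum_le_tsum fun w => ?_
        rw [← ENNReal.tsum_mul_left, ← ENNReal.tsum_add]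
        exact ENNReal.tsum_le_tsum fun a => hpoint w a

/-- The unary type of an element: the relation symbols holding on its constant tuple. -/
def unaryType (L : FirstOrder.Language) (i : ℕ) (S : L.Structure ℕ) :
    (Σ m, L.Relations m) → Prop :=
  fun r => @FirstOrder.Language.Structure.RelMap L ℕ S r.1 r.2 fun _ => i

/-- The unary types of the elements of `[n]`. -/
def unaryTypes (L : FirstOrder.Language) (n : ℕ) (S : L.Structure ℕ) :
    Fin n → (Σ m, L.Relations m) → Prop :=
  fun i => unaryType L i S

/-- The finite structure of a relational language in which the relations hold only of constant
tuples, as prescribed by the given unary types. -/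
def ofUnaryTypes (L : FirstOrder.Language) [L.IsRelational] (n : ℕ)
    (x : Fin n → (Σ m, L.Relations m) → Prop) : FinRestriction L n where
  rel m r v := ∃ j, (v = fun _ => j) ∧ x j ⟨m, r⟩
  fn _ f _ := isEmptyElim f

section

variable {L : FirstOrder.Language}

theorem measurable_unaryType (i : ℕ) : Measurable (unaryType L i) := by
  refine measurable_pi_iff.2 fun r => measurableSet_setOfPred.1 ?_
  refine MeasurableSpace.measurableSet_generateFrom ?_
  let t : Fin r.1 → L.Term (Fin 1 ⊕ Fin 0) := fun _ => FirstOrder.Language.Term.var (Sum.inl 0)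
  refine ⟨1, FirstOrder.Language.Relations.boundedFormula r.2 t, ?_, fun _ => i, ?_⟩
  · exact (FirstOrder.Language.BoundedFormula.IsAtomic.rel r.2 t).isQF
  · ext S
    exact Iff.rfl

theorem measurable_unaryTypes (n : ℕ) : Measurable (unaryTypes L n) :=
  measurable_pi_iff.2 fun i => measurable_unaryType i

theorem unaryType_logicAction (σ : Equiv.Perm ℕ) (i : ℕ) (S : L.Structure ℕ) :
    unaryType L i (logicAction L σ S) = unaryType L (σ.symm i) S :=
  rfl

theorem measurableSet_unaryType_ne [∀ m, Countable (L.Relations m)] (i j : ℕ) :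
    MeasurableSet {S : L.Structure ℕ | unaryType L i S ≠ unaryType L j S} := by
  have : {S : L.Structure ℕ | unaryType L i S ≠ unaryType L j S} =
      ⋃ r, {S | ¬ (unaryType L i S r ↔ unaryType L j S r)} := by
    ext S
    simp [funext_iff]
  rw [this]
  refine MeasurableSet.iUnion fun r => measurableSet_setOfPred.2 ?_
  exact ((measurable_pi_iff.1 (measurable_unaryType i) r).iff
    (measurable_pi_iff.1 (measurable_unaryType j) r)).not

theorem aemeasurable_logicAction {μ : Measure (L.Structure ℕ)} (hμ : IsInvariantMeasure L μ)
    (σ : Equiv.Perm ℕ) : AEMeasurable (logicAction L σ) μ := by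
  have := hμ.1
  refine AEMeasurable.of_map_ne_zero ?_
  rw [hμ.2 σ]
  exact IsProbabilityMeasure.ne_zero μ

theorem measure_unaryType_ne [∀ m, Countable (L.Relations m)] {μ : Measure (L.Structure ℕ)}
    (hμ : IsInvariantMeasure L μ) {i j : ℕ} (hij : i ≠ j) :
    μ {S | unaryType L i S ≠ unaryType L j S} = μ {S | unaryType L 0 S ≠ unaryType L 1 S} := by
  let τ : Equiv.Perm ℕ := Equiv.swap 0 i
  have hτj : τ j ≠ 0 := fun h => hij (τ.injective ((Equiv.swap_apply_right 0 i).trans h.symm))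
  let σ : Equiv.Perm ℕ := τ.trans (Equiv.swap 1 (τ j))
  have hi : σ.symm 0 = i := by
    rw [Equiv.symm_apply_eq]
    simp [σ, τ, Equiv.swap_apply_of_ne_of_ne, hτj.symm]
  have hj : σ.symm 1 = j := by
    rw [Equiv.symm_apply_eq]
    simp [σ]
  conv_rhs => rw [← hμ.2 σ]
  rw [Measure.map_apply_of_aemeasurable (aemeasurable_logicAction hμ σ)
    (measurableSet_unaryType_ne 0 1)]
  simp only [Set.preimage_ofPred_eq, unaryType_logicAction, hi, hj]

theorem map_unaryTypes_unaryType_succ {μ : Measure (L.Structure ℕ)}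
    (hμ : IsInvariantMeasure L μ) (n : ℕ) :
    Measure.map (fun S => (unaryTypes L n S, unaryType L n S)) μ =
      Measure.map (fun S => (unaryTypes L n S, unaryType L (n + 1) S)) μ := by
  have hm : Measurable fun S => (unaryTypes L n S, unaryType L n S) :=
    (measurable_unaryTypes n).prodMk (measurable_unaryType n)
  conv_lhs => rw [← hμ.2 (Equiv.swap n (n + 1))]
  rw [AEMeasurable.map_map_of_aemeasurable hm.aemeasurable (aemeasurable_logicAction hμ _)]
  congr 1
  funext S
  refine Prod.ext (funext fun i => ?_) ?_
  · change unaryType L ((Equiv.swap n (n + 1)).symm i) S = unaryType L i S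
    rw [Equiv.symm_swap, Equiv.swap_apply_of_ne_of_ne] <;> omega
  · change unaryType L ((Equiv.swap n (n + 1)).symm n) S = unaryType L (n + 1) S
    rw [Equiv.symm_swap, Equiv.swap_apply_left]

variable [L.IsRelational]

instance finRestrictionMeasurableSingletonClass [∀ m, Countable (L.Relations m)] (n : ℕ) :
    MeasurableSingletonClass (FinRestriction L n) where
  measurableSet_singleton x := by
    have : ({x} : Set (FinRestriction L n)) =
        ⋂ (m) (r) (v), {y : FinRestriction L n | y.rel m r v ↔ x.rel m r v} := by
      ext y
      simp only [Set.mem_singleton_iff, Set.mem_iInter, Set.mem_ofPred_eq]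
      refine ⟨fun h => by simp [h], fun h => ?_⟩
      cases x
      cases y
      congr 1
      · funext m r v
        exact propext (h m r v)
      · funext m f
        exact isEmptyElim f
    rw [this]
    refine MeasurableSet.iInter fun m => MeasurableSet.iInter fun r =>
      MeasurableSet.iInter fun v => ?_
    have hrel : Measurable fun y : FinRestriction L n => y.rel m r v :=
      measurableSet_setOfPred.1 (MeasurableSpace.measurableSet_generateFrom
        (Or.inl ⟨m, r, v, rfl⟩))
    exact measurableSet_setOfPred.2 (hrel.iff measurable_const)

theorem measurable_ofUnaryTypes (n : ℕ) : Measurable (ofUnaryTypes L n) := by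
  refine measurable_generateFrom ?_
  rintro _ (⟨m, r, v, rfl⟩ | ⟨m, f, v, o, rfl⟩)
  · refine measurableSet_setOfPred.2 (Measurable.exists fun j => measurable_const.and ?_)
    exact measurable_pi_iff.1 (measurable_pi_apply j) _
  · exact isEmptyElim f

theorem ofUnaryTypes_injective (harity : ∀ m, m ≠ 1 → IsEmpty (L.Relations m)) (n : ℕ) :
    Function.Injective (ofUnaryTypes L n) := by
  intro x y hxy
  funext j ⟨m, r⟩
  obtain rfl : m = 1 := by
    by_contra h
    exact (harity m h).elim r
  have key (z : Fin n → (Σ m, L.Relations m) → Prop) :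
      (ofUnaryTypes L n z).rel 1 r (fun _ => j) ↔ z j ⟨1, r⟩ := by
    refine ⟨?_, fun h => ⟨j, rfl, h⟩⟩
    rintro ⟨k, hk, h⟩
    rwa [congrFun hk 0]
  exact propext ((key x).symm.trans (hxy ▸ key y))

theorem restrict_eq_ofUnaryTypes (harity : ∀ m, m ≠ 1 → IsEmpty (L.Relations m)) (n : ℕ)
    (S : L.Structure ℕ) : restrict L n S = ofUnaryTypes L n (unaryTypes L n S) := by
  unfold restrict ofUnaryTypes
  congr 1
  · funext m r v
    obtain rfl : m = 1 := by
      by_contra h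
      exact (harity m h).elim r
    have hv : v = fun _ => v 0 := funext fun k => congrArg v (Subsingleton.elim _ _)
    refine propext ⟨fun h => ⟨v 0, hv, ?_⟩, ?_⟩
    · rw [hv] at h
      exact h
    · rintro ⟨j, rfl, h⟩
      exact h
  · funext m f
    exact isEmptyElim f

theorem entFn_eq_entropy_unaryTypes [∀ m, Countable (L.Relations m)]
    (harity : ∀ m, m ≠ 1 → IsEmpty (L.Relations m)) (μ : Measure (L.Structure ℕ)) (n : ℕ) :
    entFn L μ n = entropy (Measure.map (unaryTypes L n) μ) := by
  rw [← entropy_map_of_injective _ (measurable_ofUnaryTypes n) (ofUnaryTypes_injective harity n),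
    Measure.map_map (measurable_ofUnaryTypes n) (measurable_unaryTypes n)]
  unfold entFn
  congr 2
  exact funext (restrict_eq_ofUnaryTypes harity n)

theorem entFn_add_half_measure_unaryType_ne_le [∀ m, Countable (L.Relations m)]
    (harity : ∀ m, m ≠ 1 → IsEmpty (L.Relations m)) {μ : Measure (L.Structure ℕ)}
    (hμ : IsInvariantMeasure L μ) (n : ℕ) :
    entFn L μ n + ENNReal.ofReal (1 / 2) * μ {S | unaryType L 0 S ≠ unaryType L 1 S} ≤
      entFn L μ (n + 1) := by
  have := hμ.1
  rw [entFn_eq_entropy_unaryTypes harity, entFn_eq_entropy_unaryTypes harity,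
    ← measure_unaryType_ne hμ (Nat.ne_of_lt n.lt_succ_self)]
  refine (entropy_add_half_measure_ne_le μ (measurable_unaryTypes n) (measurable_unaryType n)
    (measurable_unaryType (n + 1)) (map_unaryTypes_unaryType_succ hμ n)).trans_eq ?_
  let split : (Fin (n + 1) → (Σ m, L.Relations m) → Prop) →
      (Fin n → (Σ m, L.Relations m) → Prop) × ((Σ m, L.Relations m) → Prop) :=
    fun x => (fun i => x i.castSucc, x (Fin.last n))
  have hsplit : Measurable split := by fun_prop
  have hinj : Function.Injective split := by
    intro x y hxy
    funext i
    induction i using Fin.lastCases with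
    | last => exact congrArg Prod.snd hxy
    | cast i => exact congrFun (congrArg Prod.fst hxy) i
  rw [← entropy_map_of_injective _ hsplit hinj, Measure.map_map hsplit (measurable_unaryTypes _)]
  rfl

theorem entFn_eq_entFn_one_of_unaryType_eq [∀ m, Countable (L.Relations m)]
    (harity : ∀ m, m ≠ 1 → IsEmpty (L.Relations m)) {μ : Measure (L.Structure ℕ)}
    (hμ : IsInvariantMeasure L μ) (h0 : μ {S | unaryType L 0 S ≠ unaryType L 1 S} = 0)
    {n : ℕ} (hn : 1 ≤ n) : entFn L μ n = entFn L μ 1 := by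
  let diag : (Fin 1 → (Σ m, L.Relations m) → Prop) → Fin n → (Σ m, L.Relations m) → Prop :=
    fun x _ => x 0
  have hdiag : Measurable diag := by fun_prop
  have hinj : Function.Injective diag := by
    intro x y hxy
    funext i
    rw [Subsingleton.elim i 0]
    exact congrFun hxy ⟨0, hn⟩
  rw [entFn_eq_entropy_unaryTypes harity, entFn_eq_entropy_unaryTypes harity,
    ← entropy_map_of_injective _ hdiag hinj, Measure.map_map hdiag (measurable_unaryTypes _)]
  congr 1
  refine Measure.map_congr ?_
  have hall (i : ℕ) : ∀ᵐ S ∂μ, unaryType L i S = unaryType L 0 S := by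
    rcases eq_or_ne i 0 with rfl | hi
    · exact Filter.Eventually.of_forall fun _ => rfl
    · exact (measure_unaryType_ne hμ hi).trans h0
  filter_upwards [ae_all_iff.2 hall] with S hS
  exact funext fun i => hS i

end

end PaperEntropy

open PaperEntropy MeasureTheory
open scoped ENNReal

/-- For a countable relational language all of whose relation symbols
are unary, the entropy function of a non-redundant invariant measure of sublinear growth
is constant on positive integers. -/
theorem entFn_constant_of_sublinear_unary
    (L : FirstOrder.Language) (_ : L.IsRelational)
    (_ : ∀ m, Countable (L.Relations m))
    (harity : ∀ m, m ≠ 1 → IsEmpty (L.Relations m))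
    (μ : Measure (L.Structure ℕ)) (hμ : IsInvariantMeasure L μ)
    (hnr : μ (NonRedundant L ℕ) = 1)
    (hsub : Filter.Tendsto (fun n : ℕ => entFn L μ n / (n : ℝ≥0∞)) Filter.atTop (nhds 0)) :
    ∃ c : ℝ≥0∞, ∀ n : ℕ, 1 ≤ n → entFn L μ n = c := by
  have := hμ.1
  set δ := ENNReal.ofReal (1 / 2) * μ {S | unaryType L 0 S ≠ unaryType L 1 S} with hδ
  have hlin (n : ℕ) : n * δ ≤ entFn L μ n := by
    induction n with
    | zero => simp
    | succ n ih =>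
      refine le_trans ?_ (entFn_add_half_measure_unaryType_ne_le harity hμ n)
      rw [Nat.cast_succ, add_mul, one_mul]
      gcongr
  have hδ0 : δ = 0 := by
    refine le_antisymm (ge_of_tendsto hsub ?_) zero_le
    filter_upwards [Filter.eventually_ge_atTop 1] with n hn
    rw [ENNReal.le_div_iff_mul_le (Or.inl (by positivity)) (Or.inl (ENNReal.natCast_ne_top n)),
      mul_comm]
    exact hlin n
  have h0 : μ {S | unaryType L 0 S ≠ unaryType L 1 S} = 0 := by
    simpa [hδ] using hδ0
  exact ⟨entFn L μ 1, fun n hn => entFn_eq_entFn_one_of_unaryType_eq harity hμ h0 hn⟩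
end
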